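/- arXiv:1307.1162 — 2 statements merged into one kernel-verified Lean document; each statement's English description precedes it below -/
import Mathlib

section
/- Let Y denote the set of smooth space-compact maps ζ = (A₀, A⃗) : ℝ×ℝ³ → ℝ×ℝ³ solving the free Maxwell equations ΔA₀ = ∂_t div A⃗ and ∂_t²A⃗ = ΔA⃗ + ∇(∂_tA₀ − div A⃗), and let ω be the presymplectic form ω(ζ₁,ζ₂) := ∫_{ℝ³} (−E⃗₁(0,x)·A⃗₂(0,x) + A⃗₁(0,x)·E⃗₂(0,x)) dx, where E⃗ᵢ := ∂_tA⃗ᵢ − ∇A_{i,0} is the electric field of ζᵢ. Then for ζ ∈ Y the following are equivalent: (1) ζ belongs to the kernel of ω, i.e. ω(ξ,ζ) = 0 for every ξ ∈ Y; (2) ζ is a pure gauge, i.e. there exists a smooth function χ : ℝ×ℝ³ → ℝ with A₀ = ∂_tχ and A⃗ = ∇χ. -/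
open Topology MeasureTheory

noncomputable section

/-- Physical space `ℝ³`. -/
abbrev Sp3 := EuclideanSpace ℝ (Fin 3)

/-- The `i`-th coordinate direction in `ℝ³`. -/
def sdir (i : Fin 3) : Sp3 := EuclideanSpace.single i 1

/-- Partial derivative of `f : ℝ³ → ℝ` in the `i`-th coordinate direction. -/
def pd (i : Fin 3) (f : Sp3 → ℝ) (x : Sp3) : ℝ := fderiv ℝ f x (sdir i)

/-- The Laplacian of `f : ℝ³ → ℝ`. -/
def lap (f : Sp3 → ℝ) (x : Sp3) : ℝ := ∑ i, pd i (fun y => pd i f y) x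

/-- A function on spacetime is space-compact if its (closed) support intersected with
every time slab `[-T,T] × ℝ³` is compact. -/
def SpaceCompact (f : ℝ → Sp3 → ℝ) : Prop :=
  ∀ T : ℝ, IsCompact (tsupport (fun p : ℝ × Sp3 => f p.1 p.2)
    ∩ Set.Icc (-T) T ×ˢ (Set.univ : Set Sp3))

/-- The divergence of the vector field with components `A i`. -/
def divg (A : Fin 3 → ℝ → Sp3 → ℝ) (t : ℝ) (x : Sp3) : ℝ := ∑ j, pd j (A j t) x

/-- The `i`-th component of the electric field of the potential `(A₀, A)`. -/
def efield (A₀ : ℝ → Sp3 → ℝ) (A : Fin 3 → ℝ → Sp3 → ℝ) (i : Fin 3) (t : ℝ) (x : Sp3) : ℝ :=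
  deriv (fun r => A i r x) t - pd i (A₀ t) x

/-- `(A₀, A)` is a smooth space-compact solution of the free Maxwell equations. -/
def IsMaxwell (A₀ : ℝ → Sp3 → ℝ) (A : Fin 3 → ℝ → Sp3 → ℝ) : Prop :=
  ContDiff ℝ (⊤ : ℕ∞) (fun p : ℝ × Sp3 => A₀ p.1 p.2) ∧
  (∀ i, ContDiff ℝ (⊤ : ℕ∞) (fun p : ℝ × Sp3 => A i p.1 p.2)) ∧
  SpaceCompact A₀ ∧ (∀ i, SpaceCompact (A i)) ∧
  (∀ (t : ℝ) (x : Sp3), lap (A₀ t) x = deriv (fun r => divg A r x) t) ∧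
  (∀ (i : Fin 3) (t : ℝ) (x : Sp3),
    deriv (deriv (fun r => A i r x)) t
      = lap (fun y => A i t y) x
        + pd i (fun y => deriv (fun r => A₀ r y) t - divg A t y) x)

/-- The presymplectic form on the space of solutions of the Maxwell equations,
evaluated on the time-zero slice. -/
def symplMax (B₀ : ℝ → Sp3 → ℝ) (B : Fin 3 → ℝ → Sp3 → ℝ)
    (A₀ : ℝ → Sp3 → ℝ) (A : Fin 3 → ℝ → Sp3 → ℝ) : ℝ :=
  ∫ x : Sp3, ∑ i, (-(efield B₀ B i 0 x) * A i 0 x + B i 0 x * efield A₀ A i 0 x)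

open scoped ContDiff

/-- The average over `s ∈ [-1, 1]`, with weight `(1 - s²) ^ n`, of `f (t + s * r)`. -/
def lineMean (n : ℕ) (f : ℝ → ℝ) (q : ℝ × ℝ) : ℝ :=
  ∫ s in (-1 : ℝ)..1, (1 - s ^ 2) ^ n * f (q.1 + s * q.2)

theorem hasFDerivAt_lineMean_aux {f : ℝ → ℝ} (hf : ContDiff ℝ ∞ f) (n : ℕ) (q : ℝ × ℝ) :
    HasFDerivAt (lineMean n f)
      (∫ s in (-1 : ℝ)..1, ((1 - s ^ 2) ^ n * deriv f (q.1 + s * q.2)) •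
        (ContinuousLinearMap.fst ℝ ℝ ℝ + s • ContinuousLinearMap.snd ℝ ℝ ℝ)) q := by
  have hf0 : Continuous f := hf.continuous
  have hf1 : Continuous (deriv f) := hf.continuous_deriv (by simp)
  have hcont : Continuous fun z : (ℝ × ℝ) × ℝ =>
      ((1 - z.2 ^ 2) ^ n * deriv f (z.1.1 + z.2 * z.1.2)) •
        (ContinuousLinearMap.fst ℝ ℝ ℝ + z.2 • ContinuousLinearMap.snd ℝ ℝ ℝ) := by fun_prop
  obtain ⟨C, hC⟩ := ((isCompact_closedBall q 1).prod
    (isCompact_Icc (a := (-1 : ℝ)) (b := 1))).exists_bound_of_continuousOn hcont.continuousOn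
  refine intervalIntegral.hasFDerivAt_integral_of_dominated_of_fderiv_le
    (F := fun q s => (1 - s ^ 2) ^ n * f (q.1 + s * q.2))
    (F' := fun q s => ((1 - s ^ 2) ^ n * deriv f (q.1 + s * q.2)) •
        (ContinuousLinearMap.fst ℝ ℝ ℝ + s • ContinuousLinearMap.snd ℝ ℝ ℝ))
    (bound := fun _ => C) (Metric.closedBall_mem_nhds q one_pos) ?_ ?_ ?_ ?_ ?_ ?_
  · exact .of_forall fun x => Continuous.aestronglyMeasurable (by fun_prop)
  · exact Continuous.intervalIntegrable (by fun_prop) _ _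
  · exact Continuous.aestronglyMeasurable (by fun_prop)
  · refine .of_forall fun s hs x hx => hC (x, s) ⟨hx, ?_⟩
    rw [Set.uIoc_of_le (by norm_num)] at hs
    exact ⟨hs.1.le, hs.2⟩
  · exact intervalIntegrable_const
  · refine .of_forall fun s _ x _ => ?_
    have h1 : HasFDerivAt (fun q : ℝ × ℝ => q.1 + s * q.2)
        (ContinuousLinearMap.fst ℝ ℝ ℝ + s • ContinuousLinearMap.snd ℝ ℝ ℝ) x :=
      hasFDerivAt_fst.add (hasFDerivAt_snd.const_mul s)
    have h2 := ((hf.differentiable (by simp)) (x.1 + s * x.2)).hasDerivAt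
    simpa [smul_smul, mul_assoc] using (h2.comp_hasFDerivAt x h1).const_mul ((1 - s ^ 2) ^ n)

theorem integral_deriv_mul_comp_line {f p p' : ℝ → ℝ} (hf : ContDiff ℝ ∞ f)
    (hp : ∀ s, HasDerivAt p (p' s) s) (hp' : Continuous p') (h₁ : p 1 = 0) (h₂ : p (-1) = 0)
    (t r : ℝ) :
    r * ∫ s in (-1 : ℝ)..1, p s * deriv f (t + s * r) = -∫ s in (-1 : ℝ)..1, p' s * f (t + s * r) := by
  have hf0 : Continuous f := hf.continuous
  have hf1 : Continuous (deriv f) := hf.continuous_deriv (by simp)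
  have hd : ∀ s ∈ Set.uIcc (-1 : ℝ) 1, HasDerivAt (fun s => f (t + s * r))
      (r * deriv f (t + s * r)) s := fun s _ => by
    have h2 := ((hf.differentiable (by simp)) (t + s * r)).hasDerivAt
    have h1 : HasDerivAt (fun s : ℝ => t + s * r) r s := by
      simpa using ((hasDerivAt_id s).mul_const r).const_add t
    simpa [mul_comm, Function.comp_def] using h2.comp s h1
  have := intervalIntegral.integral_mul_deriv_eq_deriv_mul (fun s _ => hp s) hd
    (hp'.intervalIntegrable _ _) (Continuous.intervalIntegrable (by fun_prop) _ _)
  rw [h₁, h₂] at this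
  rw [← intervalIntegral.integral_const_mul]
  simp only [zero_mul, sub_zero, zero_sub] at this
  rw [← this]
  exact intervalIntegral.integral_congr fun s _ => by ring

theorem hasDerivAt_weight (n : ℕ) (s : ℝ) :
    HasDerivAt (fun s : ℝ => (1 - s ^ 2) ^ (n + 1)) (-(2 * (n + 1)) * (s * (1 - s ^ 2) ^ n)) s := by
  have h := (((hasDerivAt_id s).pow 2).const_sub 1).pow (n + 1)
  refine (h.congr_deriv ?_)
  simp
  ring

theorem hasFDerivAt_lineMean {f : ℝ → ℝ} (hf : ContDiff ℝ ∞ f) (n : ℕ) (q : ℝ × ℝ) :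
    HasFDerivAt (lineMean n f)
      (lineMean n (deriv f) q • ContinuousLinearMap.fst ℝ ℝ ℝ +
        (q.2 * (lineMean (n + 1) (deriv (deriv f)) q / (2 * (n + 1)))) •
          ContinuousLinearMap.snd ℝ ℝ ℝ) q := by
  have hf1' : ContDiff ℝ ∞ (deriv f) := (contDiff_infty_iff_deriv.1 hf).2
  have hf1 : Continuous (deriv f) := hf1'.continuous
  convert hasFDerivAt_lineMean_aux hf n q using 1
  have h := integral_deriv_mul_comp_line hf1' (hasDerivAt_weight n) (by fun_prop) (by simp)
    (by simp) q.1 q.2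
  have h2 : q.2 * (lineMean (n + 1) (deriv (deriv f)) q / (2 * (n + 1))) =
      ∫ s in (-1 : ℝ)..1, (1 - s ^ 2) ^ n * deriv f (q.1 + s * q.2) * s := by
    rw [← mul_div_assoc, lineMean, h, div_eq_iff (by positivity), ← intervalIntegral.integral_neg,
      ← intervalIntegral.integral_mul_const]
    exact intervalIntegral.integral_congr fun s _ => by ring
  simp only [smul_add, smul_smul]
  rw [intervalIntegral.integral_add (Continuous.intervalIntegrable (by fun_prop) _ _)
    (Continuous.intervalIntegrable (by fun_prop) _ _), intervalIntegral.integral_smul_const,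
    intervalIntegral.integral_smul_const, h2, lineMean]

/-- The radial function `x ↦ ∫ (1 - s²) ^ n f (t + s ‖x‖) ds`. For `n = 0` it solves the wave
equation in three space dimensions. -/
def radialMean {E : Type*} [NormedAddCommGroup E] (n : ℕ) (f : ℝ → ℝ) (p : ℝ × E) : ℝ :=
  lineMean n f (p.1, ‖p.2‖)

section RadialMean

variable {E : Type*} [NormedAddCommGroup E] [InnerProductSpace ℝ E]

theorem hasFDerivAt_radialMean {f : ℝ → ℝ} (hf : ContDiff ℝ ∞ f) (n : ℕ) (p : ℝ × E) :
    HasFDerivAt (radialMean n f)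
      (radialMean n (deriv f) p • ContinuousLinearMap.fst ℝ ℝ E +
        (radialMean (n + 1) (deriv (deriv f)) p / (2 * (n + 1))) •
          (innerSL ℝ p.2 ∘L ContinuousLinearMap.snd ℝ ℝ E)) p := by
  obtain ⟨t, x⟩ := p
  have hq := hasFDerivAt_lineMean hf n (t, ‖x‖)
  by_cases hx : x = 0
  · subst hx
    simp only [norm_zero, zero_mul, zero_smul, add_zero, map_zero, ContinuousLinearMap.zero_comp,
      smul_zero] at hq ⊢
    rw [hasFDerivAt_iff_isLittleO_nhds_zero] at hq ⊢
    have ht : Filter.Tendsto (fun h : ℝ × E => (h.1, ‖h.2‖)) (𝓝 0) (𝓝 0) := by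
      have : Continuous fun h : ℝ × E => (h.1, ‖h.2‖) := by fun_prop
      exact this.tendsto' 0 0 (by simp)
    have hO : (fun h : ℝ × E => (h.1, ‖h.2‖)) =O[𝓝 0] fun h : ℝ × E => h :=
      .of_bound 1 (.of_forall fun h => by simp [Prod.norm_def])
    have h := (hq.comp_tendsto ht).trans_isBigO hO
    simpa [Function.comp_def, radialMean] using h
  · have hn : HasFDerivAt (fun y : E => ‖y‖) (‖x‖⁻¹ • innerSL ℝ x) x := by
      have h := (hasStrictFDerivAt_norm_sq x).hasFDerivAt.sqrt (by simpa using hx)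
      simp only [Real.sqrt_sq (norm_nonneg _)] at h
      convert h using 1
      ext y
      simp
      field_simp
    have h1 : HasFDerivAt (fun p : ℝ × E => (p.1, ‖p.2‖))
        ((ContinuousLinearMap.fst ℝ ℝ E).prod
          ((‖x‖⁻¹ • innerSL ℝ x) ∘L ContinuousLinearMap.snd ℝ ℝ E)) (t, x) :=
      hasFDerivAt_fst.prodMk (hn.comp (t, x) hasFDerivAt_snd)
    refine (hq.comp (t, x) h1).congr_fderiv ?_
    ext y
    · simp [radialMean]
    · have : ‖x‖ ≠ 0 := by simpa using hx
      simp [radialMean]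
      field_simp

theorem contDiff_radialMean {f : ℝ → ℝ} (hf : ContDiff ℝ ∞ f) (n : ℕ) :
    ContDiff ℝ ∞ (radialMean (E := E) n f) := by
  rw [contDiff_infty]
  intro m
  induction m generalizing n f with
  | zero =>
    exact contDiff_zero.2 (continuous_iff_continuousAt.2
      fun p => (hasFDerivAt_radialMean hf n p).continuousAt)
  | succ m ih =>
    have hf1 : ContDiff ℝ ∞ (deriv f) := (contDiff_infty_iff_deriv.1 hf).2
    have hf2 : ContDiff ℝ ∞ (deriv (deriv f)) := (contDiff_infty_iff_deriv.1 hf1).2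
    refine contDiff_succ_iff_hasFDerivAt.2 ⟨_, ?_, hasFDerivAt_radialMean hf n⟩
    refine ((ih hf1 n).smul contDiff_const).add (((ih hf2 (n + 1)).div_const _).smul ?_)
    exact ((innerSL ℝ).contDiff.comp contDiff_snd).clm_comp contDiff_const

end RadialMean

/-- The derivative of `P` in the direction `v`. -/
def dirD {E : Type*} [NormedAddCommGroup E] [NormedSpace ℝ E] (v : E) (P : E → ℝ) (p : E) : ℝ :=
  fderiv ℝ P p v

section DirD

variable {E : Type*} [NormedAddCommGroup E] [NormedSpace ℝ E] {P Q : E → ℝ}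

theorem ContDiff.dirD (hP : ContDiff ℝ ∞ P) (v : E) : ContDiff ℝ ∞ (dirD v P) :=
  (contDiff_infty_iff_fderiv.1 hP).2.clm_apply contDiff_const

theorem dirD_comm (hP : ContDiff ℝ ∞ P) (v w : E) : dirD v (dirD w P) = dirD w (dirD v P) := by
  have h := (contDiff_infty_iff_fderiv.1 hP).2.differentiable (by simp)
  have hs : ∀ p, IsSymmSndFDerivAt ℝ P p := fun p =>
    hP.contDiffAt.isSymmSndFDerivAt (by
      rw [minSmoothness_of_isRCLikeNormedField]
      exact ENat.LEInfty.out)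
  have key : ∀ v w p, dirD v (dirD w P) p = fderiv ℝ (fderiv ℝ P) p v w := fun v w p => by
    have := ((h p).hasFDerivAt.clm_apply (hasFDerivAt_const w p)).fderiv
    change fderiv ℝ (fun q => fderiv ℝ P q w) p v = _
    rw [this]
    simp
  funext p
  rw [key, key, hs p]

theorem dirD_add (hP : ContDiff ℝ ∞ P) (hQ : ContDiff ℝ ∞ Q) (v : E) :
    dirD v (fun p => P p + Q p) = fun p => dirD v P p + dirD v Q p := by
  funext p
  simp only [dirD]
  rw [fderiv_fun_add (hP.differentiable (by simp) p) (hQ.differentiable (by simp) p)]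
  rfl

theorem dirD_sub (hP : ContDiff ℝ ∞ P) (hQ : ContDiff ℝ ∞ Q) (v : E) :
    dirD v (fun p => P p - Q p) = fun p => dirD v P p - dirD v Q p := by
  funext p
  simp only [dirD]
  rw [fderiv_fun_sub (hP.differentiable (by simp) p) (hQ.differentiable (by simp) p)]
  rfl

theorem dirD_mul (hP : ContDiff ℝ ∞ P) (hQ : ContDiff ℝ ∞ Q) (v : E) :
    dirD v (fun p => P p * Q p) = fun p => P p * dirD v Q p + Q p * dirD v P p := by
  funext p
  simp only [dirD]
  rw [fderiv_fun_mul (hP.differentiable (by simp) p) (hQ.differentiable (by simp) p)]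
  rfl

theorem dirD_const_mul (hP : ContDiff ℝ ∞ P) (c : ℝ) (v : E) :
    dirD v (fun p => c * P p) = fun p => c * dirD v P p := by
  funext p
  simp only [dirD]
  rw [fderiv_const_mul (hP.differentiable (by simp) p)]
  rfl

theorem dirD_sum {ι : Type*} {s : Finset ι} {P : ι → E → ℝ} (hP : ∀ i ∈ s, ContDiff ℝ ∞ (P i))
    (v : E) : dirD v (fun p => ∑ i ∈ s, P i p) = fun p => ∑ i ∈ s, dirD v (P i) p := by
  funext p
  simp only [dirD]
  rw [fderiv_fun_sum fun i hi => (hP i hi).differentiable (by simp) p]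
  simp

theorem dirD_comp_sub (v a : E) : dirD v (fun p => P (p - a)) = fun p => dirD v P (p - a) := by
  funext p
  simp only [dirD]
  rw [fderiv_comp_sub]

end DirD

/-- The time direction in spacetime. -/
def tdir : ℝ × Sp3 := (1, 0)

/-- The `i`-th spatial direction in spacetime. -/
def xdir (i : Fin 3) : ℝ × Sp3 := (0, sdir i)

theorem deriv_time_slice {P : ℝ × Sp3 → ℝ} (hP : ContDiff ℝ ∞ P) (t : ℝ) (x : Sp3) :
    deriv (fun r => P (r, x)) t = dirD tdir P (t, x) := by
  have h := (hP.differentiable (by simp) (t, x)).hasFDerivAt.comp_hasDerivAt t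
    ((hasDerivAt_id t).prodMk (hasDerivAt_const t x))
  exact h.deriv

theorem pd_space_slice {P : ℝ × Sp3 → ℝ} (hP : ContDiff ℝ ∞ P) (i : Fin 3) (t : ℝ) (x : Sp3) :
    pd i (fun y => P (t, y)) x = dirD (xdir i) P (t, x) := by
  have h := (hP.differentiable (by simp) (t, x)).hasFDerivAt.comp x
    ((hasFDerivAt_const t x).prodMk (hasFDerivAt_id x))
  have h' := h.fderiv
  simp only [Function.comp_def] at h'
  simp [pd, dirD, h', xdir]

theorem dirD_tdir_radialMean {f : ℝ → ℝ} (hf : ContDiff ℝ ∞ f) (n : ℕ) :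
    dirD tdir (radialMean (E := Sp3) n f) = radialMean n (deriv f) := by
  funext p
  simp [dirD, tdir, (hasFDerivAt_radialMean hf n p).fderiv]

theorem dirD_xdir_radialMean {f : ℝ → ℝ} (hf : ContDiff ℝ ∞ f) (n : ℕ) (i : Fin 3) :
    dirD (xdir i) (radialMean n f) =
      fun p : ℝ × Sp3 => (2 * ((n : ℝ) + 1))⁻¹ * (p.2 i * radialMean (n + 1) (deriv (deriv f)) p) := by
  funext p
  simp [dirD, xdir, sdir, (hasFDerivAt_radialMean hf n p).fderiv, EuclideanSpace.inner_single_right]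
  field_simp

theorem lineMean_zero_eq {g : ℝ → ℝ} (hg : ContDiff ℝ ∞ g) (q : ℝ × ℝ) :
    lineMean 0 g q =
      3 / 2 * lineMean 1 g q + q.2 ^ 2 / 8 * lineMean 2 (deriv (deriv g)) q := by
  have hg1 : ContDiff ℝ ∞ (deriv g) := (contDiff_infty_iff_deriv.1 hg).2
  have hg0 : Continuous g := hg.continuous
  have h1 := integral_deriv_mul_comp_line hg1 (hasDerivAt_weight 1) (by fun_prop) (by simp)
    (by simp) q.1 q.2
  have h2 := integral_deriv_mul_comp_line (p := fun s => s * (1 - s ^ 2))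
    (p' := fun s => 1 - 3 * s ^ 2) hg (fun s => by
      refine ((hasDerivAt_id s).mul (((hasDerivAt_id s).pow 2).const_sub 1)).congr_deriv ?_
      simp
      ring) (by fun_prop) (by simp) (by simp) q.1 q.2
  have h3 : q.2 ^ 2 * lineMean 2 (deriv (deriv g)) q =
      -4 * ∫ s in (-1 : ℝ)..1, (1 - 3 * s ^ 2) * g (q.1 + s * q.2) := by
    have h4 : q.2 * lineMean 2 (deriv (deriv g)) q =
        4 * ∫ s in (-1 : ℝ)..1, s * (1 - s ^ 2) * deriv g (q.1 + s * q.2) := by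
      rw [lineMean, h1, ← intervalIntegral.integral_neg, ← intervalIntegral.integral_const_mul]
      exact intervalIntegral.integral_congr fun s _ => by simp; ring
    rw [sq, mul_assoc, h4, mul_left_comm, h2]
    ring
  rw [div_mul_eq_mul_div (q.2 ^ 2), h3]
  simp only [lineMean]
  rw [← intervalIntegral.integral_const_mul, ← intervalIntegral.integral_const_mul,
    ← intervalIntegral.integral_div, ← intervalIntegral.integral_add
    (Continuous.intervalIntegrable (by fun_prop) _ _)
    (Continuous.intervalIntegrable (by fun_prop) _ _)]
  exact intervalIntegral.integral_congr fun s _ => by simp; ring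

theorem contDiff_coord (i : Fin 3) : ContDiff ℝ ∞ fun p : ℝ × Sp3 => p.2 i := by fun_prop

theorem radialMean_wave {f : ℝ → ℝ} (hf : ContDiff ℝ ∞ f) (p : ℝ × Sp3) :
    dirD tdir (dirD tdir (radialMean 0 f)) p =
      ∑ i, dirD (xdir i) (dirD (xdir i) (radialMean 0 f)) p := by
  have hf1 : ContDiff ℝ ∞ (deriv f) := (contDiff_infty_iff_deriv.1 hf).2
  have hf2 : ContDiff ℝ ∞ (deriv (deriv f)) := (contDiff_infty_iff_deriv.1 hf1).2
  have hc : ∀ i, dirD (xdir i) (fun p : ℝ × Sp3 => p.2 i) p = 1 := fun i => by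
    have h : HasFDerivAt (fun p : ℝ × Sp3 => p.2 i)
        (EuclideanSpace.proj i ∘L ContinuousLinearMap.snd ℝ ℝ Sp3) p :=
      (EuclideanSpace.proj i ∘L ContinuousLinearMap.snd ℝ ℝ Sp3).hasFDerivAt
    simp [dirD, h.fderiv, xdir, sdir]
  rw [dirD_tdir_radialMean hf, dirD_tdir_radialMean hf1]
  have hW1 := contDiff_radialMean (E := Sp3) hf2 1
  have key : ∀ i, dirD (xdir i) (dirD (xdir i) (radialMean 0 f)) p =
      2⁻¹ * (radialMean 1 (deriv (deriv f)) p +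
        4⁻¹ * p.2 i ^ 2 * radialMean 2 (deriv (deriv (deriv (deriv f)))) p) := fun i => by
    rw [dirD_xdir_radialMean hf]
    simp only [Nat.cast_zero, zero_add, mul_one]
    rw [dirD_const_mul ((contDiff_coord i).mul hW1), dirD_mul (contDiff_coord i) hW1]
    simp only
    rw [hc, dirD_xdir_radialMean hf2]
    norm_num
    ring
  simp only [key]
  have hn : ‖p.2‖ ^ 2 = p.2 0 ^ 2 + p.2 1 ^ 2 + p.2 2 ^ 2 := by
    rw [EuclideanSpace.norm_sq_eq]
    simp [Fin.sum_univ_three]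
  have h := lineMean_zero_eq hf2 (p.1, ‖p.2‖)
  simp only [hn] at h
  simp only [radialMean, h, Fin.sum_univ_three]
  ring

/-- On every bounded time slab, `P` vanishes outside a compact subset of space. -/
def SlabSupported (P : ℝ × Sp3 → ℝ) : Prop :=
  ∀ T : ℝ, ∃ K : Set Sp3, IsCompact K ∧ ∀ t x, |t| ≤ T → x ∉ K → P (t, x) = 0

theorem eventually_eq_zero_of_slab {P : ℝ × Sp3 → ℝ} {T : ℝ} {K : Set Sp3} (hK : IsCompact K)
    (hz : ∀ t x, |t| ≤ T + 1 → x ∉ K → P (t, x) = 0) {t : ℝ} {x : Sp3} (ht : |t| ≤ T)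
    (hx : x ∉ K) : P =ᶠ[𝓝 (t, x)] 0 := by
  have hopen : IsOpen (Set.Ioo (-(T + 1)) (T + 1) ×ˢ Kᶜ) :=
    isOpen_Ioo.prod hK.isClosed.isOpen_compl
  have hmem : (t, x) ∈ Set.Ioo (-(T + 1)) (T + 1) ×ˢ Kᶜ := by
    have := abs_le.1 ht
    exact ⟨⟨by linarith, by linarith⟩, hx⟩
  filter_upwards [hopen.mem_nhds hmem] with q hq
  exact hz q.1 q.2 (abs_le.2 ⟨hq.1.1.le, hq.1.2.le⟩) hq.2

theorem spaceCompact_iff {P : ℝ × Sp3 → ℝ} :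
    SpaceCompact (fun t x => P (t, x)) ↔ SlabSupported P := by
  constructor
  · intro h T
    refine ⟨_, (h T).image continuous_snd, fun t x ht hx => ?_⟩
    by_contra hne
    exact hx ⟨(t, x), ⟨subset_tsupport _ hne, ⟨abs_le.1 ht, trivial⟩⟩, rfl⟩
  · intro h T
    obtain ⟨K, hK, hz⟩ := h (T + 1)
    have hcl : IsClosed (Set.Icc (-T) T ×ˢ (Set.univ : Set Sp3)) := isClosed_Icc.prod isClosed_univ
    refine ((isCompact_Icc (a := -T) (b := T)).prod hK).of_isClosed_subset
      ((isClosed_tsupport _).inter hcl) ?_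
    rintro ⟨t, x⟩ ⟨hs, ht, -⟩
    refine ⟨ht, ?_⟩
    by_contra hx
    exact notMem_tsupport_iff_eventuallyEq.2
      (eventually_eq_zero_of_slab hK hz (abs_le.2 ht) hx) hs

theorem SlabSupported.directional {P : ℝ × Sp3 → ℝ} (h : SlabSupported P) (v : ℝ × Sp3) :
    SlabSupported (dirD v P) := by
  intro T
  obtain ⟨K, hK, hz⟩ := h (T + 1)
  refine ⟨K, hK, fun t x ht hx => ?_⟩
  simp [dirD, (eventually_eq_zero_of_slab hK hz ht hx).fderiv_eq]

theorem SlabSupported.mul_left {P : ℝ × Sp3 → ℝ} (h : SlabSupported P) (Q : ℝ × Sp3 → ℝ) :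
    SlabSupported fun p => Q p * P p := fun T => by
  obtain ⟨K, hK, hz⟩ := h T
  exact ⟨K, hK, fun t x ht hx => by simp [hz t x ht hx]⟩

theorem SlabSupported.sub {P Q : ℝ × Sp3 → ℝ} (hP : SlabSupported P) (hQ : SlabSupported Q) :
    SlabSupported fun p => P p - Q p := fun T => by
  obtain ⟨K, hK, hz⟩ := hP T
  obtain ⟨L, hL, hw⟩ := hQ T
  refine ⟨K ∪ L, hK.union hL, fun t x ht hx => ?_⟩
  rw [Set.mem_union, not_or] at hx
  simp [hz t x ht hx.1, hw t x ht hx.2]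

theorem SlabSupported.sum {ι : Type*} [Fintype ι] {P : ι → ℝ × Sp3 → ℝ}
    (h : ∀ i, SlabSupported (P i)) : SlabSupported fun p => ∑ i, P i p := fun T => by
  choose K hK hz using fun i => h i T
  refine ⟨⋃ i, K i, isCompact_iUnion hK, fun t x ht hx => Finset.sum_eq_zero fun i _ => ?_⟩
  exact hz i t x ht fun hi => hx (Set.mem_iUnion_of_mem i hi)

theorem SlabSupported.hasCompactSupport {P : ℝ × Sp3 → ℝ} (h : SlabSupported P) (t : ℝ) :
    HasCompactSupport fun x => P (t, x) := by
  obtain ⟨K, hK, hz⟩ := h |t|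
  exact .intro hK fun x hx => hz t x le_rfl hx

theorem lineMean_zero_eq_zero {f : ℝ → ℝ} {ε : ℝ} (hε : 0 < ε) (hf : Continuous f)
    (hodd : ∀ s, f (-s) = -f s) (hsupp : ∀ s, ε ≤ |s| → f s = 0) {t r : ℝ} (hr : |t| + ε ≤ r) :
    lineMean 0 f (t, r) = 0 := by
  have hr0 : 0 < r := by have := abs_nonneg t; linarith
  have ht := abs_le.1 (show |t| ≤ r - ε by linarith)
  have h1 := intervalIntegral.mul_integral_comp_add_mul (a := -1) (b := 1) (f := f) r t
  have h2 : ∫ s in (t + r * -1)..(t + r * 1), f s = 0 := by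
    have hi : ∀ a b, IntervalIntegrable f volume a b := fun a b => hf.intervalIntegrable a b
    rw [← intervalIntegral.integral_add_adjacent_intervals (hi _ (-ε)) (hi _ _),
      ← intervalIntegral.integral_add_adjacent_intervals (hi (-ε) ε) (hi _ _)]
    have hl : ∫ s in (t + r * -1)..(-ε), f s = 0 := by
      rw [intervalIntegral.integral_congr (g := fun _ => 0), intervalIntegral.integral_zero]
      intro s hs
      rw [Set.uIcc_of_le (by linarith)] at hs
      exact hsupp s (le_abs.2 (Or.inr (by linarith [hs.2])))
    have hh : ∫ s in ε..(t + r * 1), f s = 0 := by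
      rw [intervalIntegral.integral_congr (g := fun _ => 0), intervalIntegral.integral_zero]
      intro s hs
      rw [Set.uIcc_of_le (by linarith)] at hs
      exact hsupp s (le_abs.2 (Or.inl hs.1))
    have hm : ∫ s in (-ε)..ε, f s = 0 := by
      have := intervalIntegral.integral_comp_neg (a := -ε) (b := ε) f
      simp only [hodd, intervalIntegral.integral_neg, neg_neg] at this
      linarith
    rw [hl, hm, hh]
    simp
  rw [h2] at h1
  simp only [lineMean, pow_zero, one_mul]
  simp_rw [mul_comm _ r]
  exact (mul_eq_zero.1 h1).resolve_left hr0.ne'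

theorem exists_bump_wave (y : Sp3) {ε : ℝ} (hε : 0 < ε) :
    ∃ v : ℝ × Sp3 → ℝ, ContDiff ℝ ∞ v ∧ SlabSupported v ∧
      (∀ p, dirD tdir (dirD tdir v) p = ∑ i, dirD (xdir i) (dirD (xdir i) v) p) ∧
      (∀ x, v (0, x) = 0) ∧ (∀ x, 0 ≤ dirD tdir v (0, x)) ∧ 0 < dirD tdir v (0, y) ∧
      ∀ x, ε ≤ dist x y → dirD tdir v (0, x) = 0 := by
  let β : ContDiffBump (0 : ℝ) := ⟨ε / 2, ε, by positivity, by linarith⟩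
  have hβ : ContDiff ℝ ∞ β := β.contDiff
  let f : ℝ → ℝ := fun s => s * β s
  have hf : ContDiff ℝ ∞ f := contDiff_id.mul hβ
  have hodd : ∀ s, f (-s) = -f s := fun s => by simp [f, β.neg]
  have hβz : ∀ s, ε ≤ |s| → β s = 0 := fun s hs => β.zero_of_le_dist (by simpa using hs)
  have hsupp : ∀ s, ε ≤ |s| → f s = 0 := fun s hs => by simp [f, hβz s hs]
  let v : ℝ × Sp3 → ℝ := fun p => radialMean 0 f (p - (0, y))
  have hR := contDiff_radialMean (E := Sp3) hf 0
  have hv : ContDiff ℝ ∞ v := hR.comp (contDiff_id.sub contDiff_const)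
  have hvt : ∀ x, dirD tdir v (0, x) = 2 * β ‖x - y‖ := fun x => by
    rw [dirD_comp_sub, dirD_tdir_radialMean hf]
    simp only [radialMean, lineMean, Prod.mk_sub_mk, sub_zero, pow_zero, one_mul, zero_add]
    have hd : ∀ s : ℝ, HasDerivAt (fun s => s * β (s * ‖x - y‖)) (deriv f (s * ‖x - y‖)) s := by
      intro s
      have hb : ∀ z, HasDerivAt β (deriv β z) z := fun z =>
        ((hβ.differentiable (by simp)) z).hasDerivAt
      have h1 : deriv f (s * ‖x - y‖) =
          β (s * ‖x - y‖) + (s * ‖x - y‖) * deriv β (s * ‖x - y‖) := by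
        have : HasDerivAt f _ (s * ‖x - y‖) := (hasDerivAt_id (s * ‖x - y‖)).mul (hb _)
        simpa using this.deriv
      rw [h1]
      have h2 : HasDerivAt (fun s => β (s * ‖x - y‖)) (deriv β (s * ‖x - y‖) * ‖x - y‖) s := by
        have h3 : HasDerivAt (fun s : ℝ => s * ‖x - y‖) ‖x - y‖ s := by
          simpa using (hasDerivAt_id s).mul_const ‖x - y‖
        exact (hb _).comp s h3
      refine ((hasDerivAt_id s).mul h2).congr_deriv ?_
      simp
      ring
    have hf1 : Continuous (deriv f) := hf.continuous_deriv (by simp)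
    rw [intervalIntegral.integral_eq_sub_of_hasDerivAt (fun s _ => hd s)
      (Continuous.intervalIntegrable (by fun_prop) _ _)]
    simp [β.neg]
    ring
  refine ⟨v, hv, ?_, ?_, ?_, ?_, ?_, ?_⟩
  · intro T
    refine ⟨Metric.closedBall y (T + ε), isCompact_closedBall _ _, fun t x ht hx => ?_⟩
    rw [Metric.mem_closedBall, not_le, dist_eq_norm] at hx
    simp only [v, radialMean, Prod.mk_sub_mk, sub_zero]
    exact lineMean_zero_eq_zero hε hf.continuous hodd hsupp (by linarith)
  · intro p
    simp only [v, dirD_comp_sub, radialMean_wave hf]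
  · intro x
    simp only [v, radialMean, lineMean, Prod.mk_sub_mk, sub_zero, pow_zero, one_mul, zero_add]
    have := intervalIntegral.integral_comp_neg (a := -1) (b := 1) fun s => f (s * ‖x - y‖)
    simp only [neg_mul, hodd, intervalIntegral.integral_neg, neg_neg] at this
    linarith
  · intro x
    rw [hvt]
    exact mul_nonneg zero_le_two β.nonneg
  · rw [hvt]
    exact mul_pos two_pos (β.pos_of_mem_ball (by simpa using hε))
  · intro x hx
    rw [hvt, hβz _ (by rwa [abs_norm, ← dist_eq_norm]), mul_zero]

theorem SlabSupported.integrable {P : ℝ × Sp3 → ℝ} (h : SlabSupported P) (hP : Continuous P)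
    (t : ℝ) : Integrable fun x => P (t, x) :=
  Continuous.integrable_of_hasCompactSupport (by fun_prop) (h.hasCompactSupport t)

theorem SlabSupported.integral_dirD_xdir {P : ℝ × Sp3 → ℝ} (h : SlabSupported P)
    (hP : ContDiff ℝ ∞ P) (i : Fin 3) (t : ℝ) : ∫ x, dirD (xdir i) P (t, x) = 0 := by
  have hs : ContDiff ℝ ∞ fun x => P (t, x) := hP.comp (contDiff_const.prodMk contDiff_id)
  have hd : ∀ x, fderiv ℝ (fun x => P (t, x)) x (sdir i) = dirD (xdir i) P (t, x) :=
    fun x => pd_space_slice hP i t x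
  have := integral_mul_fderiv_eq_neg_fderiv_mul_of_integrable (μ := (volume : Measure Sp3))
    (f := fun _ => (1 : ℝ)) (g := fun x => P (t, x)) (v := sdir i) (by simp)
    (by simpa [hd] using (h.directional (xdir i)).integrable (hP.dirD _).continuous t)
    (by simpa using h.integrable hP.continuous t) (fun x _ => by fun_prop)
    (fun x _ => hs.differentiable (by simp) x)
  simpa [hd] using this

theorem SlabSupported.integral_sum_dirD_xdir {Q : Fin 3 → ℝ × Sp3 → ℝ}
    (h : ∀ j, SlabSupported (Q j)) (hQ : ∀ j, ContDiff ℝ ∞ (Q j)) (t : ℝ) :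
    ∫ x, ∑ j, dirD (xdir j) (Q j) (t, x) = 0 := by
  rw [integral_finsetSum _ fun j _ =>
    ((h j).directional (xdir j)).integrable ((hQ j).dirD _).continuous t]
  exact Finset.sum_eq_zero fun j _ => (h j).integral_dirD_xdir (hQ j) j t

theorem SlabSupported.hasDerivAt_integral {P : ℝ × Sp3 → ℝ} (h : SlabSupported P)
    (hP : ContDiff ℝ ∞ P) (t : ℝ) :
    HasDerivAt (fun t => ∫ x, P (t, x)) (∫ x, dirD tdir P (t, x)) t := by
  have hc : Continuous P := hP.continuous
  have hc' : Continuous (dirD tdir P) := (hP.dirD tdir).continuous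
  obtain ⟨K, hK, hz⟩ := h.directional tdir (|t| + 1)
  obtain ⟨C, hC⟩ := ((isCompact_closedBall t 1).prod hK).exists_bound_of_continuousOn
    hc'.continuousOn
  refine (hasDerivAt_integral_of_dominated_loc_of_deriv_le (F := fun t x => P (t, x))
    (F' := fun t x => dirD tdir P (t, x)) (bound := K.indicator fun _ => C)
    (Metric.closedBall_mem_nhds t one_pos) ?_ ?_ ?_ ?_ ?_ ?_).2
  · exact .of_forall fun s => Continuous.aestronglyMeasurable (by fun_prop)
  · exact h.integrable hc t
  · exact Continuous.aestronglyMeasurable (by fun_prop)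
  · refine .of_forall fun x s hs => ?_
    by_cases hx : x ∈ K
    · simpa [hx] using hC (s, x) ⟨hs, hx⟩
    · have hst : |s| ≤ |t| + 1 := by
        rw [Metric.mem_closedBall, Real.dist_eq] at hs
        have := abs_sub_abs_le_abs_sub s t
        linarith
      simp [hx, hz s x hst hx]
  · exact (integrable_indicator_iff hK.measurableSet).2
      (integrableOn_const hK.measure_lt_top.ne)
  · refine .of_forall fun x s _ => ?_
    rw [← deriv_time_slice hP]
    exact ((hP.comp (contDiff_id.prodMk contDiff_const)).differentiable (by simp) s).hasDerivAt

theorem SlabSupported.integral_eq_of_conservation_law {P : ℝ × Sp3 → ℝ}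
    {Q : Fin 3 → ℝ × Sp3 → ℝ} (hs : SlabSupported P) (hP : ContDiff ℝ ∞ P)
    (hsQ : ∀ j, SlabSupported (Q j)) (hQ : ∀ j, ContDiff ℝ ∞ (Q j))
    (h : ∀ p, dirD tdir P p = ∑ j, dirD (xdir j) (Q j) p) (t s : ℝ) :
    ∫ x, P (t, x) = ∫ x, P (s, x) := by
  have hd : ∀ t, HasDerivAt (fun t => ∫ x, P (t, x)) 0 t := fun t => by
    have := hs.hasDerivAt_integral hP t
    simp only [h] at this
    rwa [SlabSupported.integral_sum_dirD_xdir hsQ hQ] at this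
  exact is_const_of_deriv_eq_zero (fun t => (hd t).differentiableAt) (fun t => (hd t).deriv) t s

theorem eq_zero_of_integral_bump_wave {g : Sp3 → ℝ} (hg : Continuous g)
    (h : ∀ v : ℝ × Sp3 → ℝ, ContDiff ℝ ∞ v → SlabSupported v →
      (∀ p, dirD tdir (dirD tdir v) p = ∑ i, dirD (xdir i) (dirD (xdir i) v) p) →
      (∀ x, v (0, x) = 0) → ∫ x, dirD tdir v (0, x) * g x = 0) (y : Sp3) : g y = 0 := by
  have key : ∀ g : Sp3 → ℝ, Continuous g →
      (∀ v : ℝ × Sp3 → ℝ, ContDiff ℝ ∞ v → SlabSupported v →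
      (∀ p, dirD tdir (dirD tdir v) p = ∑ i, dirD (xdir i) (dirD (xdir i) v) p) →
      (∀ x, v (0, x) = 0) → ∫ x, dirD tdir v (0, x) * g x = 0) → g y ≤ 0 := by
    intro g hg h
    by_contra! hy
    obtain ⟨ε, hε, hball⟩ := Metric.eventually_nhds_iff.1 (hg.continuousAt.eventually (lt_mem_nhds hy))
    obtain ⟨v, hv, hs, hw, h0, hpos, hposy, hz⟩ := exists_bump_wave y hε
    refine (h v hv hs hw h0).not_gt ?_
    have hvt : Continuous (dirD tdir v) := (hv.dirD tdir).continuous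
    refine Continuous.integral_pos_of_hasCompactSupport_nonneg_nonzero (x := y) (by fun_prop)
      (((hs.directional tdir).hasCompactSupport 0).mul_right) (fun x => ?_) (mul_pos hposy hy).ne'
    rcases lt_or_ge (dist x y) ε with hx | hx
    · exact mul_nonneg (hpos x) (hball hx).le
    · simp [hz x hx]
  refine le_antisymm (key g hg h) (neg_nonpos.1 (key (fun x => -g x) hg.neg ?_))
  intro v hv hs hw h0
  simp [integral_neg, h v hv hs hw h0]

theorem exists_potential {a₀ : ℝ × Sp3 → ℝ} {a : Fin 3 → ℝ × Sp3 → ℝ} (h₀ : ContDiff ℝ ∞ a₀)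
    (h : ∀ i, ContDiff ℝ ∞ (a i)) (hE : ∀ i p, dirD tdir (a i) p = dirD (xdir i) a₀ p)
    (hB : ∀ i j p, dirD (xdir i) (a j) p = dirD (xdir j) (a i) p) :
    ∃ χ : ℝ × Sp3 → ℝ, ContDiff ℝ ∞ χ ∧ (∀ p, dirD tdir χ p = a₀ p) ∧
      ∀ i p, dirD (xdir i) χ p = a i p := by
  let α : ℝ × Sp3 → (ℝ × Sp3 →L[ℝ] ℝ) := fun p => a₀ p • ContinuousLinearMap.fst ℝ ℝ Sp3 +
    ∑ i, a i p • (EuclideanSpace.proj i ∘L ContinuousLinearMap.snd ℝ ℝ Sp3)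
  have hα : ContDiff ℝ ∞ α :=
    (h₀.smul contDiff_const).add (ContDiff.sum fun i _ => (h i).smul contDiff_const)
  have hαd : Differentiable ℝ α := hα.differentiable (by simp)
  have hexp : ∀ (P : ℝ × Sp3 → ℝ) (u p : ℝ × Sp3),
      dirD u P p = u.1 * dirD tdir P p + ∑ i, u.2 i * dirD (xdir i) P p := fun P u p => by
    have hu : u = u.1 • tdir + ∑ i, u.2 i • xdir i := by
      ext k
      · simp [tdir, xdir, Prod.fst_sum]
      · fin_cases k <;> simp [tdir, xdir, sdir, Fin.sum_univ_three]
    simp only [dirD]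
    conv_lhs => rw [hu]
    simp
  have hαu : ∀ u w p, fderiv ℝ α p u w = w.1 * dirD u a₀ p + ∑ i, w.2 i * dirD u (a i) p :=
    fun u w p => by
      have h1 := ((hαd p).hasFDerivAt.clm_apply (hasFDerivAt_const w p)).fderiv
      have h2 : fderiv ℝ α p u w = dirD u (fun q => α q w) p := by
        simp only [dirD]
        rw [h1]
        simp
      have h3 : (fun q => α q w) = fun q => w.1 * a₀ q + ∑ i, w.2 i * a i q := by
        funext q
        simp [α, mul_comm]
      have h4 : ∀ i, ContDiff ℝ ∞ fun q => w.2 i * a i q := fun i => contDiff_const.mul (h i)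
      rw [h2, h3, dirD_add (contDiff_const.mul h₀) (ContDiff.sum fun i _ => h4 i),
        dirD_const_mul h₀, dirD_sum fun i _ => h4 i]
      simp only [dirD_const_mul (h _)]
  obtain ⟨χ, hχ⟩ := convex_univ.exists_forall_hasFDerivAt_of_fderiv_symmetric isOpen_univ
    hαd.differentiableOn fun p _ u w => by
      rw [hαu, hαu]
      simp only [hexp _ u, hexp _ w, Fin.sum_univ_three, hE, hB 1 0, hB 2 0, hB 2 1]
      ring
  have hχd : fderiv ℝ χ = α := funext fun p => (hχ p trivial).fderiv
  refine ⟨χ, contDiff_infty_iff_fderiv.2 ⟨fun p => (hχ p trivial).differentiableAt, ?_⟩, ?_, ?_⟩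
  · rwa [hχd]
  · intro p
    simp [dirD, hχd, α, tdir]
  · intro i p
    simp [dirD, hχd, α, xdir, sdir]

theorem isMaxwell_iff {a₀ : ℝ × Sp3 → ℝ} {a : Fin 3 → ℝ × Sp3 → ℝ} (h₀ : ContDiff ℝ ∞ a₀)
    (h : ∀ i, ContDiff ℝ ∞ (a i)) :
    IsMaxwell (fun t x => a₀ (t, x)) (fun i t x => a i (t, x)) ↔
      SlabSupported a₀ ∧ (∀ i, SlabSupported (a i)) ∧
      (∀ p, ∑ i, dirD (xdir i) (dirD (xdir i) a₀) p = ∑ j, dirD tdir (dirD (xdir j) (a j)) p) ∧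
      ∀ i p, dirD tdir (dirD tdir (a i)) p = ∑ j, dirD (xdir j) (dirD (xdir j) (a i)) p +
        (dirD (xdir i) (dirD tdir a₀) p - ∑ j, dirD (xdir i) (dirD (xdir j) (a j)) p) := by
  have hdiv : ContDiff ℝ ∞ fun p => ∑ j, dirD (xdir j) (a j) p :=
    ContDiff.sum fun j _ => (h j).dirD _
  have hsrc : ContDiff ℝ ∞ fun p => dirD tdir a₀ p - ∑ j, dirD (xdir j) (a j) p :=
    (h₀.dirD _).sub hdiv
  have hlap : ∀ {P : ℝ × Sp3 → ℝ}, ContDiff ℝ ∞ P → ∀ t x,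
      lap (fun y => P (t, y)) x = ∑ i, dirD (xdir i) (dirD (xdir i) P) (t, x) :=
    fun {P} hP t x => by
      simp only [lap, pd_space_slice hP, pd_space_slice (hP.dirD _)]
  have hdivt : ∀ t x, deriv (fun r => ∑ j, dirD (xdir j) (a j) (r, x)) t =
      ∑ j, dirD tdir (dirD (xdir j) (a j)) (t, x) := fun t x => by
    rw [deriv_time_slice hdiv, dirD_sum fun j _ => (h j).dirD _]
  have hsrcx : ∀ i t x,
      pd i (fun y => dirD tdir a₀ (t, y) - ∑ j, dirD (xdir j) (a j) (t, y)) x =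
      dirD (xdir i) (dirD tdir a₀) (t, x) -
        ∑ j, dirD (xdir i) (dirD (xdir j) (a j)) (t, x) := fun i t x => by
    rw [pd_space_slice hsrc, dirD_sub (h₀.dirD _) hdiv, dirD_sum fun j _ => (h j).dirD _]
  have htt : ∀ i t x, deriv (deriv fun r => a i (r, x)) t = dirD tdir (dirD tdir (a i)) (t, x) :=
    fun i t x => by
      have : (deriv fun r => a i (r, x)) = fun r => dirD tdir (a i) (r, x) :=
        funext fun r => deriv_time_slice (h i) r x
      rw [this, deriv_time_slice ((h i).dirD _)]
  simp only [IsMaxwell, spaceCompact_iff, divg, hlap h₀, hlap (h _), pd_space_slice (h _), hdivt,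
    htt, deriv_time_slice h₀, hsrcx, Prod.forall]
  exact ⟨fun H => ⟨H.2.2.1, H.2.2.2.1, H.2.2.2.2.1, H.2.2.2.2.2⟩,
    fun H => ⟨h₀, h, H.1, H.2.1, H.2.2.1, H.2.2.2⟩⟩

/-- The electric field of a potential, as a function on spacetime. -/
def elec (a₀ : ℝ × Sp3 → ℝ) (a : Fin 3 → ℝ × Sp3 → ℝ) (i : Fin 3) (p : ℝ × Sp3) : ℝ :=
  dirD tdir (a i) p - dirD (xdir i) a₀ p

/-- The magnetic part of the field strength of a potential. -/
def magn (a : Fin 3 → ℝ × Sp3 → ℝ) (i j : Fin 3) (p : ℝ × Sp3) : ℝ :=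
  dirD (xdir i) (a j) p - dirD (xdir j) (a i) p

section Fields

variable {a₀ : ℝ × Sp3 → ℝ} {a : Fin 3 → ℝ × Sp3 → ℝ}

theorem efield_eq_elec (h₀ : ContDiff ℝ ∞ a₀) (h : ∀ i, ContDiff ℝ ∞ (a i)) (i : Fin 3) (t : ℝ)
    (x : Sp3) : efield (fun t x => a₀ (t, x)) (fun i t x => a i (t, x)) i t x =
      elec a₀ a i (t, x) := by
  rw [efield, deriv_time_slice (h i), pd_space_slice h₀, elec]

theorem contDiff_elec (h₀ : ContDiff ℝ ∞ a₀) (h : ∀ i, ContDiff ℝ ∞ (a i)) (i : Fin 3) :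
    ContDiff ℝ ∞ (elec a₀ a i) := ((h i).dirD _).sub (h₀.dirD _)

theorem contDiff_magn (h : ∀ i, ContDiff ℝ ∞ (a i)) (i j : Fin 3) :
    ContDiff ℝ ∞ (magn a i j) := ((h j).dirD _).sub ((h i).dirD _)

theorem dirD_elec (h₀ : ContDiff ℝ ∞ a₀) (h : ∀ i, ContDiff ℝ ∞ (a i)) (i : Fin 3)
    (v p : ℝ × Sp3) :
    dirD v (elec a₀ a i) p = dirD v (dirD tdir (a i)) p - dirD v (dirD (xdir i) a₀) p := by
  change dirD v (fun p => _ - _) p = _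
  rw [dirD_sub ((h i).dirD _) (h₀.dirD _)]

theorem dirD_magn (h : ∀ i, ContDiff ℝ ∞ (a i)) (i j : Fin 3) (v p : ℝ × Sp3) :
    dirD v (magn a i j) p = dirD v (dirD (xdir i) (a j)) p - dirD v (dirD (xdir j) (a i)) p := by
  change dirD v (fun p => _ - _) p = _
  rw [dirD_sub ((h j).dirD _) ((h i).dirD _)]

theorem faraday (h₀ : ContDiff ℝ ∞ a₀) (h : ∀ i, ContDiff ℝ ∞ (a i)) (i j : Fin 3)
    (p : ℝ × Sp3) : dirD tdir (magn a i j) p =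
      dirD (xdir i) (elec a₀ a j) p - dirD (xdir j) (elec a₀ a i) p := by
  rw [dirD_magn h, dirD_elec h₀ h, dirD_elec h₀ h, dirD_comm (h j) tdir, dirD_comm (h i) tdir,
    dirD_comm h₀ (xdir i)]
  ring

theorem gauss (h₀ : ContDiff ℝ ∞ a₀) (h : ∀ i, ContDiff ℝ ∞ (a i))
    (hM : IsMaxwell (fun t x => a₀ (t, x)) (fun i t x => a i (t, x))) (p : ℝ × Sp3) :
    ∑ i, dirD (xdir i) (elec a₀ a i) p = 0 := by
  have h1 := ((isMaxwell_iff h₀ h).1 hM).2.2.1 p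
  simp only [dirD_elec h₀ h, Finset.sum_sub_distrib, h1, sub_eq_zero]
  exact Finset.sum_congr rfl fun j _ => by rw [dirD_comm (h j)]

theorem ampere (h₀ : ContDiff ℝ ∞ a₀) (h : ∀ i, ContDiff ℝ ∞ (a i))
    (hM : IsMaxwell (fun t x => a₀ (t, x)) (fun i t x => a i (t, x))) (i : Fin 3)
    (p : ℝ × Sp3) : dirD tdir (elec a₀ a i) p = ∑ j, dirD (xdir j) (magn a j i) p := by
  have h1 := ((isMaxwell_iff h₀ h).1 hM).2.2.2 i p
  simp only [dirD_elec h₀ h, dirD_magn h, Finset.sum_sub_distrib, h1, dirD_comm h₀ tdir (xdir i)]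
  simp only [fun j => dirD_comm (h j) (xdir j) (xdir i)]
  ring

theorem SlabSupported.elec (hs₀ : SlabSupported a₀) (hs : ∀ i, SlabSupported (a i)) (i : Fin 3) :
    SlabSupported (elec a₀ a i) := ((hs i).directional _).sub (hs₀.directional _)

theorem SlabSupported.magn (hs : ∀ i, SlabSupported (a i)) (i j : Fin 3) :
    SlabSupported (magn a i j) := ((hs j).directional _).sub ((hs i).directional _)

/-- Twice the energy density of the electromagnetic field. -/
def energyDensity (a₀ : ℝ × Sp3 → ℝ) (a : Fin 3 → ℝ × Sp3 → ℝ) (p : ℝ × Sp3) : ℝ :=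
  ∑ i, (elec a₀ a i p * elec a₀ a i p + 1 / 2 * ∑ j, magn a j i p * magn a j i p)

theorem dirD_energyDensity (h₀ : ContDiff ℝ ∞ a₀) (h : ∀ i, ContDiff ℝ ∞ (a i))
    (hM : IsMaxwell (fun t x => a₀ (t, x)) (fun i t x => a i (t, x))) (p : ℝ × Sp3) :
    dirD tdir (energyDensity a₀ a) p =
      ∑ j, dirD (xdir j) (fun q => 2 * ∑ i, elec a₀ a i q * magn a j i q) p := by
  have hE := contDiff_elec h₀ h
  have hB := contDiff_magn h
  have hBB : ∀ i, ContDiff ℝ ∞ fun p => ∑ j, magn a j i p * magn a j i p := fun i =>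
    ContDiff.sum fun j _ => (hB j i).mul (hB j i)
  have hEB : ∀ j, ContDiff ℝ ∞ fun p => ∑ i, elec a₀ a i p * magn a j i p := fun j =>
    ContDiff.sum fun i _ => (hE i).mul (hB j i)
  have h1 : dirD tdir (energyDensity a₀ a) p =
      ∑ i, (2 * (elec a₀ a i p * dirD tdir (elec a₀ a i) p) +
        ∑ j, magn a j i p * dirD tdir (magn a j i) p) := by
    change dirD tdir (fun p => ∑ i, _) p = _
    rw [dirD_sum fun i _ => ((hE i).mul (hE i)).add (contDiff_const.mul (hBB i))]
    refine Finset.sum_congr rfl fun i _ => ?_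
    rw [dirD_add ((hE i).mul (hE i)) (contDiff_const.mul (hBB i)), dirD_const_mul (hBB i),
      dirD_sum fun j _ => (hB j i).mul (hB j i), dirD_mul (hE i) (hE i)]
    simp only [dirD_mul (hB _ _) (hB _ _), Finset.mul_sum]
    congr 1
    · ring
    · exact Finset.sum_congr rfl fun j _ => by ring
  have h2 : ∀ j, dirD (xdir j) (fun q => 2 * ∑ i, elec a₀ a i q * magn a j i q) p =
      2 * ∑ i, (elec a₀ a i p * dirD (xdir j) (magn a j i) p +
        magn a j i p * dirD (xdir j) (elec a₀ a i) p) := fun j => by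
    rw [dirD_const_mul (hEB j), dirD_sum fun i _ => (hE i).mul (hB j i)]
    simp only [dirD_mul (hE _) (hB _ _)]
  have hanti : ∀ i j, magn a i j p = -magn a j i p := fun i j => by simp [magn]
  rw [h1]
  simp only [h2]
  simp only [ampere h₀ h hM, faraday h₀ h, Fin.sum_univ_three, hanti 1 0, hanti 2 0, hanti 2 1,
    show ∀ i, magn a i i p = 0 from fun i => by simp [magn]]
  ring

theorem contDiff_energyDensity (h₀ : ContDiff ℝ ∞ a₀) (h : ∀ i, ContDiff ℝ ∞ (a i)) :
    ContDiff ℝ ∞ (energyDensity a₀ a) :=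
  ContDiff.sum fun i _ => ((contDiff_elec h₀ h i).mul (contDiff_elec h₀ h i)).add
    (contDiff_const.mul (ContDiff.sum fun j _ => (contDiff_magn h j i).mul (contDiff_magn h j i)))

/-- The energy method: fields that vanish at time zero vanish identically. -/
theorem fields_eq_zero (h₀ : ContDiff ℝ ∞ a₀) (h : ∀ i, ContDiff ℝ ∞ (a i))
    (hM : IsMaxwell (fun t x => a₀ (t, x)) (fun i t x => a i (t, x)))
    (hE0 : ∀ i x, elec a₀ a i (0, x) = 0) (hB0 : ∀ i j x, magn a i j (0, x) = 0) (p : ℝ × Sp3) :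
    (∀ i, elec a₀ a i p = 0) ∧ ∀ i j, magn a i j p = 0 := by
  obtain ⟨hs₀, hs, -, -⟩ := (isMaxwell_iff h₀ h).1 hM
  have hsE := SlabSupported.elec hs₀ hs
  have hsB := SlabSupported.magn hs
  have hsD : SlabSupported (energyDensity a₀ a) := fun T => by
    choose K hK hz using fun i => hsE i T
    choose L hL hw using fun j i => hsB j i T
    refine ⟨(⋃ i, K i) ∪ ⋃ j, ⋃ i, L j i, (isCompact_iUnion hK).union
      (isCompact_iUnion fun j => isCompact_iUnion fun i => hL j i), fun t x ht hx => ?_⟩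
    simp only [Set.mem_union, Set.mem_iUnion, not_or, not_exists] at hx
    simp [energyDensity, hz _ t x ht (hx.1 _), hw _ _ t x ht (hx.2 _ _)]
  have hD := contDiff_energyDensity h₀ h
  have hcons := hsD.integral_eq_of_conservation_law hD
    (Q := fun j q => 2 * ∑ i, elec a₀ a i q * magn a j i q)
    (fun j => (SlabSupported.sum fun i => (hsB j i).mul_left _).mul_left _)
    (fun j => contDiff_const.mul
      (ContDiff.sum fun i _ => (contDiff_elec h₀ h i).mul (contDiff_magn h j i)))
    (dirD_energyDensity h₀ h hM) p.1 0
  have hterm : ∀ q i, 0 ≤ elec a₀ a i q * elec a₀ a i q +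
      1 / 2 * ∑ j, magn a j i q * magn a j i q := fun q i =>
    add_nonneg (mul_self_nonneg _)
      (mul_nonneg (by norm_num) (Finset.sum_nonneg fun j _ => mul_self_nonneg _))
  have hnn : ∀ q, 0 ≤ energyDensity a₀ a q := fun q => Finset.sum_nonneg fun i _ => hterm q i
  have hp : energyDensity a₀ a p = 0 := by
    by_contra hne
    have hDc := hD.continuous
    refine (Continuous.integral_pos_of_hasCompactSupport_nonneg_nonzero (μ := volume)
      (f := fun x => energyDensity a₀ a (p.1, x)) (x := p.2) (by fun_prop)
      (hsD.hasCompactSupport p.1) (fun x => hnn _) hne).ne' ?_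
    rw [hcons]
    simp [energyDensity, hE0, hB0]
  have hi := fun i => (Finset.sum_eq_zero_iff_of_nonneg fun i _ => hterm p i).1 hp i
    (Finset.mem_univ i)
  have hsum : ∀ i, 0 ≤ ∑ j, magn a j i p * magn a j i p := fun i =>
    Finset.sum_nonneg fun j _ => mul_self_nonneg _
  refine ⟨fun i => ?_, fun i j => ?_⟩
  · have h1 := mul_self_nonneg (elec a₀ a i p)
    exact mul_self_eq_zero.1 (by linarith [hi i, hsum i])
  · have h1 := mul_self_nonneg (elec a₀ a j p)
    have h2 : ∑ i, magn a i j p * magn a i j p = 0 := by linarith [hi j, hsum j]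
    exact mul_self_eq_zero.1 ((Finset.sum_eq_zero_iff_of_nonneg
      fun i _ => mul_self_nonneg (magn a i j p)).1 h2 i (Finset.mem_univ i))

end Fields

section TestSolutions

variable {v : ℝ × Sp3 → ℝ}

theorem wave_dirD (hv : ContDiff ℝ ∞ v)
    (hw : ∀ p, dirD tdir (dirD tdir v) p = ∑ i, dirD (xdir i) (dirD (xdir i) v) p)
    (u p : ℝ × Sp3) : dirD tdir (dirD tdir (dirD u v)) p =
      ∑ i, dirD (xdir i) (dirD (xdir i) (dirD u v)) p := by
  have h := congrArg (fun f => dirD u f p) (funext hw)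
  rw [dirD_sum fun i _ => (hv.dirD _).dirD _, dirD_comm (hv.dirD _), dirD_comm hv] at h
  rw [h]
  exact Finset.sum_congr rfl fun i _ => by rw [dirD_comm (hv.dirD _), dirD_comm hv]

theorem dirD_xdir_eq_zero (hv : ContDiff ℝ ∞ v) {t : ℝ} (h : ∀ x, v (t, x) = 0) (i : Fin 3)
    (x : Sp3) : dirD (xdir i) v (t, x) = 0 := by
  rw [← pd_space_slice hv]
  simp [h, pd]

theorem dirD_zero (u p : ℝ × Sp3) : dirD u (fun _ => 0) p = 0 := by
  simp [dirD]

theorem dirD_sum_const_mul (hv : ContDiff ℝ ∞ v) (c : Fin 3 → ℝ) (u : ℝ × Sp3) :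
    dirD u (fun p => ∑ j, c j * dirD (xdir j) v p) =
      fun p => ∑ j, c j * dirD u (dirD (xdir j) v) p := by
  rw [dirD_sum fun j _ => contDiff_const.mul (hv.dirD _)]
  simp only [dirD_const_mul (hv.dirD _)]

theorem dirD_dirD_sum_const_mul (hv : ContDiff ℝ ∞ v) (c : Fin 3 → ℝ) (u w : ℝ × Sp3) :
    dirD w (dirD u (fun p => ∑ j, c j * dirD (xdir j) v p)) =
      fun p => ∑ j, c j * dirD w (dirD u (dirD (xdir j) v)) p := by
  rw [dirD_sum_const_mul hv, dirD_sum fun j _ => contDiff_const.mul ((hv.dirD _).dirD _)]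
  simp only [dirD_const_mul ((hv.dirD _).dirD _)]

theorem isMaxwell_electric (hv : ContDiff ℝ ∞ v) (hs : SlabSupported v)
    (hw : ∀ p, dirD tdir (dirD tdir v) p = ∑ i, dirD (xdir i) (dirD (xdir i) v) p)
    (c : Fin 3 → ℝ) :
    IsMaxwell (fun t x => ∑ j, c j * dirD (xdir j) v (t, x))
      (fun i t x => c i * dirD tdir v (t, x)) := by
  have h₀ : ContDiff ℝ ∞ fun p => ∑ j, c j * dirD (xdir j) v p :=
    ContDiff.sum fun j _ => contDiff_const.mul (hv.dirD _)
  have h : ∀ i, ContDiff ℝ ∞ fun p => c i * dirD tdir v p := fun i =>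
    contDiff_const.mul (hv.dirD _)
  refine (isMaxwell_iff h₀ h).2 ⟨SlabSupported.sum fun j => (hs.directional _).mul_left _,
    fun i => (hs.directional _).mul_left _, fun p => ?_, fun i p => ?_⟩
  · simp only [dirD_dirD_sum_const_mul hv, dirD_const_mul (hv.dirD _),
      dirD_const_mul ((hv.dirD _).dirD _)]
    rw [Finset.sum_comm]
    refine Finset.sum_congr rfl fun j _ => ?_
    rw [← Finset.mul_sum, ← wave_dirD hv hw, dirD_comm hv (xdir j)]
  · simp only [dirD_dirD_sum_const_mul hv, dirD_const_mul (hv.dirD _),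
      dirD_const_mul ((hv.dirD _).dirD _), ← Finset.mul_sum, wave_dirD hv hw,
      fun j => dirD_comm hv (xdir j) tdir]
    ring

theorem isMaxwell_magnetic (hv : ContDiff ℝ ∞ v) (hs : SlabSupported v)
    (hw : ∀ p, dirD tdir (dirD tdir v) p = ∑ i, dirD (xdir i) (dirD (xdir i) v) p)
    {M : Fin 3 → Fin 3 → ℝ} (hM : ∀ i j, M i j = -M j i) :
    IsMaxwell (fun _ _ => 0) (fun i t x => ∑ j, M i j * dirD (xdir j) v (t, x)) := by
  have h : ∀ i, ContDiff ℝ ∞ fun p => ∑ j, M i j * dirD (xdir j) v p := fun i =>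
    ContDiff.sum fun j _ => contDiff_const.mul (hv.dirD _)
  have hself : ∀ i, M i i = 0 := fun i => by linarith [hM i i]
  have hdiv : (fun p => ∑ i, dirD (xdir i) (fun p => ∑ j, M i j * dirD (xdir j) v p) p) =
      fun _ => 0 := by
    funext p
    simp only [dirD_sum_const_mul hv]
    simp only [Fin.sum_univ_three, hself, hM 1 0, hM 2 0, hM 2 1,
      dirD_comm hv (xdir 1) (xdir 0), dirD_comm hv (xdir 2) (xdir 0),
      dirD_comm hv (xdir 2) (xdir 1)]
    ring
  have hdiv' : ∀ u p, ∑ i, dirD u (dirD (xdir i) fun p => ∑ j, M i j * dirD (xdir j) v p) p =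
      0 := fun u p => by
    rw [← dirD_zero u p, ← hdiv, dirD_sum fun i _ => (h i).dirD _]
  refine (isMaxwell_iff contDiff_const h).2 ⟨fun T => ⟨∅, isCompact_empty, fun _ _ _ _ => rfl⟩,
    fun i => SlabSupported.sum fun j => (hs.directional _).mul_left _, fun p => ?_, fun i p => ?_⟩
  · rw [hdiv']
    simp [funext (dirD_zero _), dirD_zero]
  · rw [hdiv', funext (dirD_zero tdir), dirD_zero]
    simp only [dirD_dirD_sum_const_mul hv, wave_dirD hv hw]
    rw [Finset.sum_comm]
    simp [Finset.mul_sum]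

end TestSolutions

section Kernel

variable {a₀ : ℝ × Sp3 → ℝ} {a : Fin 3 → ℝ × Sp3 → ℝ}

theorem symplMax_eq {b₀ : ℝ × Sp3 → ℝ} {b : Fin 3 → ℝ × Sp3 → ℝ} (hb₀ : ContDiff ℝ ∞ b₀)
    (hb : ∀ i, ContDiff ℝ ∞ (b i)) (h₀ : ContDiff ℝ ∞ a₀) (h : ∀ i, ContDiff ℝ ∞ (a i)) :
    symplMax (fun t x => b₀ (t, x)) (fun i t x => b i (t, x)) (fun t x => a₀ (t, x))
      (fun i t x => a i (t, x)) =
    ∫ x, ∑ i, (-elec b₀ b i (0, x) * a i (0, x) + b i (0, x) * elec a₀ a i (0, x)) := by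
  simp only [symplMax, efield_eq_elec hb₀ hb, efield_eq_elec h₀ h]

theorem elec_zero_of_kernel (h₀ : ContDiff ℝ ∞ a₀) (h : ∀ i, ContDiff ℝ ∞ (a i))
    (hker : ∀ (B₀ : ℝ → Sp3 → ℝ) (B : Fin 3 → ℝ → Sp3 → ℝ), IsMaxwell B₀ B →
      symplMax B₀ B (fun t x => a₀ (t, x)) (fun i t x => a i (t, x)) = 0) (k : Fin 3) (y : Sp3) :
    elec a₀ a k (0, y) = 0 := by
  have hE := (contDiff_elec h₀ h k).continuous
  refine eq_zero_of_integral_bump_wave (g := fun x => elec a₀ a k (0, x)) (by fun_prop)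
    (fun v hv hs hw hv0 => ?_) y
  let c : Fin 3 → ℝ := Pi.single k 1
  have hb₀ : ContDiff ℝ ∞ fun p => ∑ j, c j * dirD (xdir j) v p :=
    ContDiff.sum fun j _ => contDiff_const.mul (hv.dirD _)
  have hb : ∀ i, ContDiff ℝ ∞ fun p => c i * dirD tdir v p := fun i =>
    contDiff_const.mul (hv.dirD _)
  have hx : ∀ i j x, dirD (xdir i) (dirD (xdir j) v) (0, x) = 0 := fun i j x =>
    dirD_xdir_eq_zero (hv.dirD _) (dirD_xdir_eq_zero hv hv0 j) i x
  have hzero := hker _ _ (isMaxwell_electric hv hs hw c)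
  rw [symplMax_eq (b₀ := fun p => ∑ j, c j * dirD (xdir j) v p)
    (b := fun i p => c i * dirD tdir v p) hb₀ hb h₀ h] at hzero
  refine (integral_congr_ae (.of_forall fun x => ?_)).trans hzero
  simp only [elec, dirD_sum_const_mul hv, dirD_const_mul (hv.dirD _), hx, hw]
  simp [c, Pi.single_apply]

theorem sum_mul_dirD_zero_of_kernel (h₀ : ContDiff ℝ ∞ a₀) (h : ∀ i, ContDiff ℝ ∞ (a i))
    (hker : ∀ (B₀ : ℝ → Sp3 → ℝ) (B : Fin 3 → ℝ → Sp3 → ℝ), IsMaxwell B₀ B →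
      symplMax B₀ B (fun t x => a₀ (t, x)) (fun i t x => a i (t, x)) = 0)
    {M : Fin 3 → Fin 3 → ℝ} (hM : ∀ i j, M i j = -M j i) (y : Sp3) :
    ∑ j, ∑ i, M i j * dirD (xdir j) (a i) (0, y) = 0 := by
  have hda : ∀ i j, Continuous (dirD (xdir j) (a i)) := fun i j => ((h i).dirD _).continuous
  refine eq_zero_of_integral_bump_wave
    (g := fun x => ∑ j, ∑ i, M i j * dirD (xdir j) (a i) (0, x)) (by fun_prop)
    (fun v hv hs hw hv0 => ?_) y
  have hb : ∀ i, ContDiff ℝ ∞ fun p => ∑ j, M i j * dirD (xdir j) v p := fun i =>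
    ContDiff.sum fun j _ => contDiff_const.mul (hv.dirD _)
  have hzero := hker _ _ (isMaxwell_magnetic hv hs hw hM)
  rw [symplMax_eq (b₀ := fun _ => 0) (b := fun i p => ∑ j, M i j * dirD (xdir j) v p)
    contDiff_const hb h₀ h] at hzero
  have hA : ∀ j, ContDiff ℝ ∞ fun p => ∑ i, M i j * a i p := fun j =>
    ContDiff.sum fun i _ => contDiff_const.mul (h i)
  have hsQ : ∀ j, SlabSupported fun p => (∑ i, M i j * a i p) * dirD tdir v p := fun j =>
    (hs.directional _).mul_left _
  have hQ : ∀ j, ContDiff ℝ ∞ fun p => (∑ i, M i j * a i p) * dirD tdir v p := fun j =>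
    (hA j).mul (hv.dirD _)
  have hparts := SlabSupported.integral_sum_dirD_xdir hsQ hQ 0
  have hterm : ∀ x, ∑ i, (-elec (fun _ => 0) (fun i p => ∑ j, M i j * dirD (xdir j) v p) i (0, x) *
        a i (0, x) + (∑ j, M i j * dirD (xdir j) v (0, x)) * elec a₀ a i (0, x)) =
      (∑ j, ∑ i, M i j * dirD (xdir j) (a i) (0, x)) * dirD tdir v (0, x) -
        ∑ j, dirD (xdir j) (fun p => (∑ i, M i j * a i p) * dirD tdir v p) (0, x) := fun x => by
    have hd : ∀ j, dirD (xdir j) (fun p => ∑ i, M i j * a i p) (0, x) =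
        ∑ i, M i j * dirD (xdir j) (a i) (0, x) := fun j => by
      rw [dirD_sum fun i _ => contDiff_const.mul (h i)]
      simp only [dirD_const_mul (h _)]
    simp only [dirD_mul (hA _) (hv.dirD _), hd, elec, dirD_sum_const_mul hv, dirD_zero,
      dirD_xdir_eq_zero hv hv0, dirD_comm hv tdir]
    simp only [Fin.sum_univ_three]
    ring
  have hi : Integrable fun x => ∑ j, dirD (xdir j)
      (fun p => (∑ i, M i j * a i p) * dirD tdir v p) (0, x) :=
    (SlabSupported.sum fun j => (hsQ j).directional (xdir j)).integrable
      (continuous_finsetSum _ fun j _ => ((hQ j).dirD _).continuous) 0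
  have hi' := ((hs.directional tdir).mul_left
    fun p => ∑ j, ∑ i, M i j * dirD (xdir j) (a i) p).integrable
      (by have := (hv.dirD tdir).continuous; fun_prop) 0
  simp only [hterm] at hzero
  rw [integral_sub hi' hi, hparts, sub_zero] at hzero
  simpa only [mul_comm] using hzero

theorem magn_zero_of_kernel (h₀ : ContDiff ℝ ∞ a₀) (h : ∀ i, ContDiff ℝ ∞ (a i))
    (hker : ∀ (B₀ : ℝ → Sp3 → ℝ) (B : Fin 3 → ℝ → Sp3 → ℝ), IsMaxwell B₀ B →
      symplMax B₀ B (fun t x => a₀ (t, x)) (fun i t x => a i (t, x)) = 0) (k l : Fin 3) (y : Sp3) :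
    magn a k l (0, y) = 0 := by
  have := sum_mul_dirD_zero_of_kernel h₀ h hker
    (M := fun i j => (if i = l ∧ j = k then 1 else 0) - if i = k ∧ j = l then 1 else 0)
    (fun i j => by simp only [and_comm]; ring) y
  simpa [sub_mul, ite_and, magn] using this

theorem symplMax_gauge {b₀ : ℝ × Sp3 → ℝ} {b : Fin 3 → ℝ × Sp3 → ℝ} (hb₀ : ContDiff ℝ ∞ b₀)
    (hb : ∀ i, ContDiff ℝ ∞ (b i))
    (hM : IsMaxwell (fun t x => b₀ (t, x)) (fun i t x => b i (t, x))) {χ : ℝ × Sp3 → ℝ}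
    (hχ : ContDiff ℝ ∞ χ) :
    symplMax (fun t x => b₀ (t, x)) (fun i t x => b i (t, x)) (fun t x => dirD tdir χ (t, x))
      (fun i t x => dirD (xdir i) χ (t, x)) = 0 := by
  obtain ⟨hs₀, hs, -, -⟩ := (isMaxwell_iff hb₀ hb).1 hM
  have hE := contDiff_elec hb₀ hb
  have hQ : ∀ j, ContDiff ℝ ∞ fun p => χ p * elec b₀ b j p := fun j => hχ.mul (hE j)
  have hparts := SlabSupported.integral_sum_dirD_xdir
    (fun j => (SlabSupported.elec hs₀ hs j).mul_left χ) hQ 0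
  rw [symplMax_eq hb₀ hb (hχ.dirD _) (fun i => hχ.dirD _), ← neg_eq_zero, ← integral_neg]
  refine (integral_congr_ae (.of_forall fun x => ?_)).trans hparts
  have hg := gauss hb₀ hb hM (0, x)
  have hz : ∀ i, elec (dirD tdir χ) (fun i => dirD (xdir i) χ) i (0, x) = 0 := fun i => by
    rw [elec, dirD_comm hχ, sub_self]
  simp only [dirD_mul hχ (hE _), Finset.sum_add_distrib, ← Finset.mul_sum, hg, hz, mul_zero,
    add_zero, zero_add, neg_mul, Finset.sum_neg_distrib, neg_neg]

end Kernel

/-- A space-compact solution of the free Maxwell equations lies in the kernel of the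
presymplectic form iff it is a pure gauge. -/
theorem stmt_8 (A₀ : ℝ → Sp3 → ℝ) (A : Fin 3 → ℝ → Sp3 → ℝ) (hA : IsMaxwell A₀ A) :
    (∀ (B₀ : ℝ → Sp3 → ℝ) (B : Fin 3 → ℝ → Sp3 → ℝ),
        IsMaxwell B₀ B → symplMax B₀ B A₀ A = 0)
    ↔ ∃ χ : ℝ → Sp3 → ℝ, ContDiff ℝ (⊤ : ℕ∞) (fun p : ℝ × Sp3 => χ p.1 p.2) ∧
        (∀ (t : ℝ) (x : Sp3), A₀ t x = deriv (fun r => χ r x) t) ∧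
        (∀ (i : Fin 3) (t : ℝ) (x : Sp3), A i t x = pd i (χ t) x) := by
  obtain ⟨a₀, rfl⟩ : ∃ a₀ : ℝ × Sp3 → ℝ, A₀ = fun t x => a₀ (t, x) := ⟨fun p => A₀ p.1 p.2, rfl⟩
  obtain ⟨a, rfl⟩ : ∃ a : Fin 3 → ℝ × Sp3 → ℝ, A = fun i t x => a i (t, x) :=
    ⟨fun i p => A i p.1 p.2, rfl⟩
  have h₀ : ContDiff ℝ ∞ a₀ := hA.1
  have h : ∀ i, ContDiff ℝ ∞ (a i) := hA.2.1
  constructor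
  · intro hker
    have hF := fields_eq_zero h₀ h hA (elec_zero_of_kernel h₀ h hker)
      (magn_zero_of_kernel h₀ h hker)
    obtain ⟨χ, hχ, ht, hx⟩ := exists_potential h₀ h (fun i p => sub_eq_zero.1 ((hF p).1 i))
      (fun i j p => sub_eq_zero.1 ((hF p).2 i j))
    exact ⟨fun t x => χ (t, x), hχ, fun t x => by rw [deriv_time_slice hχ, ht],
      fun i t x => by rw [pd_space_slice hχ, hx]⟩
  · rintro ⟨χ', hχ', ht, hx⟩ B₀ B hB
    obtain ⟨χ, rfl⟩ : ∃ χ : ℝ × Sp3 → ℝ, χ' = fun t x => χ (t, x) := ⟨fun p => χ' p.1 p.2, rfl⟩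
    have hχ : ContDiff ℝ ∞ χ := hχ'
    obtain rfl : a₀ = dirD tdir χ := funext fun p => by rw [← deriv_time_slice hχ, ← ht]
    obtain rfl : a = fun i => dirD (xdir i) χ := funext fun i => funext fun p => by
      rw [← pd_space_slice hχ, ← hx]
    exact symplMax_gauge (b₀ := fun p => B₀ p.1 p.2) (b := fun i p => B i p.1 p.2) hB.1 hB.2.1 hB hχ

end
end

section
/- Let ζ = (A₀, A⃗) : ℝ×ℝ³ → ℝ×ℝ³ be a smooth space-compact solution of the free Maxwell equations ΔA₀ = ∂_t div A⃗ and ∂_t²A⃗ = ΔA⃗ + ∇(∂_tA₀ − div A⃗). Then ζ is gauge-equivalent to a solution in the Lorentz gauge: there exists a smooth function χ : ℝ×ℝ³ → ℝ such that the gauge-transformed potential B := (A₀ + ∂_tχ, A⃗ + ∇χ) is space-compact, satisfies the Lorentz condition −∂_tB₀ + div B⃗ = 0 everywhere, and each of its four components satisfies the wave equation ∂_t²B = ΔB. -/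
open Topology

noncomputable section

open MeasureTheory Set Filter
open scoped ContDiff

section ParametricIntegral

theorem Continuous.integrable_of_ae_mem_isCompact {V G : Type*} [TopologicalSpace V]
    [MeasurableSpace V] [OpensMeasurableSpace V] [SecondCountableTopology V]
    [NormedAddCommGroup G] {μ : Measure V} [IsFiniteMeasure μ] {K : Set V}
    {f : V → G} (hf : Continuous f) (hK : IsCompact K) (hμ : ∀ᵐ v ∂μ, v ∈ K) :
    Integrable f μ := by
  obtain ⟨C, hC⟩ := hK.exists_bound_of_continuousOn hf.continuousOn
  exact Integrable.of_bound hf.aestronglyMeasurable C (hμ.mono hC)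

variable {E V : Type} [NormedAddCommGroup E] [NormedSpace ℝ E] [ProperSpace E]
  [NormedAddCommGroup V] [NormedSpace ℝ V] [MeasurableSpace V] [BorelSpace V]
  [SecondCountableTopology V]
  {μ : Measure V} [IsFiniteMeasure μ] {K : Set V}

theorem ContDiff.hasFDerivAt_integral_of_ae_mem_isCompact {G : Type*} [NormedAddCommGroup G]
    [NormedSpace ℝ G] {f : E × V → G} (hf : ContDiff ℝ ∞ f) (hK : IsCompact K)
    (hμ : ∀ᵐ v ∂μ, v ∈ K) (z : E) :
    HasFDerivAt (fun y => ∫ v, f (y, v) ∂μ)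
      (∫ v, (fderiv ℝ f (z, v)).comp (ContinuousLinearMap.inl ℝ E V) ∂μ) z := by
  have hc : Continuous fun p : E × V =>
      (fderiv ℝ f p).comp (ContinuousLinearMap.inl ℝ E V) :=
    (hf.continuous_fderiv (by simp)).clm_comp continuous_const
  obtain ⟨C, hC⟩ := ((isCompact_closedBall z 1).prod hK).exists_bound_of_continuousOn
    hc.continuousOn
  refine hasFDerivAt_integral_of_dominated_of_fderiv_le
    (F' := fun y v => (fderiv ℝ f (y, v)).comp (ContinuousLinearMap.inl ℝ E V))
    (bound := fun _ => C) (Metric.closedBall_mem_nhds z one_pos)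
    (Eventually.of_forall fun y =>
      (hf.continuous.comp (Continuous.prodMk_right y)).aestronglyMeasurable)
    ((hf.continuous.comp (Continuous.prodMk_right z)).integrable_of_ae_mem_isCompact hK hμ)
    (hc.comp (Continuous.prodMk_right z)).aestronglyMeasurable
    (hμ.mono fun v hv y hy => hC (y, v) ⟨hy, hv⟩) (integrable_const C)
    (Eventually.of_forall fun v y _ => ?_)
  exact (hf.differentiable (by simp) (y, v)).hasFDerivAt.comp y (hasFDerivAt_prodMk_left y v)

theorem ContDiff.integral_of_ae_mem_isCompact {G : Type} [NormedAddCommGroup G]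
    [NormedSpace ℝ G] {f : E × V → G} (hf : ContDiff ℝ ∞ f) (hK : IsCompact K)
    (hμ : ∀ᵐ v ∂μ, v ∈ K) : ContDiff ℝ ∞ fun y => ∫ v, f (y, v) ∂μ := by
  refine contDiff_infty.2 fun n => ?_
  induction n generalizing G with
  | zero =>
    exact contDiff_zero.2 (continuous_iff_continuousAt.2 fun z =>
      (hf.hasFDerivAt_integral_of_ae_mem_isCompact hK hμ z).continuousAt)
  | succ n ih =>
    push_cast
    refine contDiff_succ_iff_hasFDerivAt.2
      ⟨_, ih (f := fun p => (fderiv ℝ f p).comp (ContinuousLinearMap.inl ℝ E V)) ?_,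
        hf.hasFDerivAt_integral_of_ae_mem_isCompact hK hμ⟩
    exact (hf.fderiv_right (by simp)).clm_comp contDiff_const

theorem ContDiff.fderiv_integral_apply_of_ae_mem_isCompact {f : E × V → ℝ}
    (hf : ContDiff ℝ ∞ f) (hK : IsCompact K) (hμ : ∀ᵐ v ∂μ, v ∈ K) (z e : E) :
    fderiv ℝ (fun y => ∫ v, f (y, v) ∂μ) z e
      = ∫ v, fderiv ℝ (fun y => f (y, v)) z e ∂μ := by
  rw [(hf.hasFDerivAt_integral_of_ae_mem_isCompact hK hμ z).fderiv,
    ContinuousLinearMap.integral_apply]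
  · refine integral_congr_ae (Eventually.of_forall fun v => ?_)
    have : fderiv ℝ (fun y => f (y, v)) z =
        (fderiv ℝ f (z, v)).comp (ContinuousLinearMap.inl ℝ E V) :=
      ((hf.differentiable (by simp) (z, v)).hasFDerivAt.comp z
        (hasFDerivAt_prodMk_left z v)).fderiv
    simp only [this]
  · refine Continuous.integrable_of_ae_mem_isCompact ?_ hK hμ
    exact ((hf.continuous_fderiv (by simp)).comp (Continuous.prodMk_right z)).clm_comp
      continuous_const

end ParametricIntegral

/-- Joint smoothness of a function of time and space. -/
def IsSmooth (f : ℝ → Sp3 → ℝ) : Prop :=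
  ContDiff ℝ ∞ fun p : ℝ × Sp3 => f p.1 p.2

/-- The time derivative of a function on spacetime. -/
def timeDeriv (f : ℝ → Sp3 → ℝ) (t : ℝ) (x : Sp3) : ℝ := deriv (fun r => f r x) t

/-- The spatial derivative of a function on spacetime in the `i`-th coordinate direction. -/
def spaceDeriv (i : Fin 3) (f : ℝ → Sp3 → ℝ) (t : ℝ) (x : Sp3) : ℝ := pd i (f t) x

section Calculus

variable {f g : ℝ → Sp3 → ℝ} {i j : Fin 3}

theorem IsSmooth.contDiff_space (hf : IsSmooth f) (t : ℝ) : ContDiff ℝ ∞ (f t) :=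
  ContDiff.comp (g := fun p : ℝ × Sp3 => f p.1 p.2) hf (contDiff_prodMk_right t)

theorem IsSmooth.contDiff_time (hf : IsSmooth f) (x : Sp3) : ContDiff ℝ ∞ fun r => f r x :=
  ContDiff.comp (g := fun p : ℝ × Sp3 => f p.1 p.2) hf (contDiff_prodMk_left x)

theorem IsSmooth.differentiable_space (hf : IsSmooth f) (t : ℝ) : Differentiable ℝ (f t) :=
  (hf.contDiff_space t).differentiable (by simp)

theorem IsSmooth.differentiable_time (hf : IsSmooth f) (x : Sp3) :
    Differentiable ℝ fun r => f r x :=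
  (hf.contDiff_time x).differentiable (by simp)

theorem IsSmooth.timeDeriv_eq (hf : IsSmooth f) (t : ℝ) (x : Sp3) :
    timeDeriv f t x = fderiv ℝ (fun p : ℝ × Sp3 => f p.1 p.2) (t, x) (1, 0) := by
  have h := ((hf.differentiable (by simp) (t, x)).hasFDerivAt.comp t
    (hasFDerivAt_prodMk_left t x)).hasDerivAt.deriv
  simpa [timeDeriv, Function.comp_def] using h

theorem IsSmooth.spaceDeriv_eq (hf : IsSmooth f) (t : ℝ) (x : Sp3) :
    spaceDeriv i f t x = fderiv ℝ (fun p : ℝ × Sp3 => f p.1 p.2) (t, x) (0, sdir i) := by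
  have h := ((hf.differentiable (by simp) (t, x)).hasFDerivAt.comp x
    (hasFDerivAt_prodMk_right t x)).fderiv
  simp only [Function.comp_def] at h
  simp [spaceDeriv, pd, h]

theorem IsSmooth.smooth_timeDeriv (hf : IsSmooth f) : IsSmooth (timeDeriv f) := by
  have h : ContDiff ℝ ∞ fun p : ℝ × Sp3 =>
      fderiv ℝ (fun p : ℝ × Sp3 => f p.1 p.2) p (1, 0) :=
    (ContDiff.fderiv_right hf (by simp)).clm_apply contDiff_const
  rwa [IsSmooth, funext fun p : ℝ × Sp3 => hf.timeDeriv_eq p.1 p.2]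

theorem IsSmooth.smooth_spaceDeriv (hf : IsSmooth f) : IsSmooth (spaceDeriv i f) := by
  have h : ContDiff ℝ ∞ fun p : ℝ × Sp3 =>
      fderiv ℝ (fun p : ℝ × Sp3 => f p.1 p.2) p (0, sdir i) :=
    (ContDiff.fderiv_right hf (by simp)).clm_apply contDiff_const
  rwa [IsSmooth, funext fun p : ℝ × Sp3 => hf.spaceDeriv_eq (i := i) p.1 p.2]

theorem fderiv_fderiv_apply_comm {E : Type*} [NormedAddCommGroup E] [NormedSpace ℝ E]
    {F : E → ℝ} (hF : ContDiff ℝ ∞ F) (p a b : E) :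
    fderiv ℝ (fun q => fderiv ℝ F q a) p b = fderiv ℝ (fun q => fderiv ℝ F q b) p a := by
  have hd : DifferentiableAt ℝ (fderiv ℝ F) p :=
    (hF.fderiv_right (m := ∞) (by simp)).differentiable (by simp) p
  rw [fderiv_clm_apply hd (by fun_prop), fderiv_clm_apply hd (by fun_prop)]
  simpa using (hF.contDiffAt.isSymmSndFDerivAt (by rw [minSmoothness_of_isRCLikeNormedField]; exact WithTop.coe_le_coe.2 le_top)).eq b a

theorem IsSmooth.timeDeriv_spaceDeriv (hf : IsSmooth f) :
    timeDeriv (spaceDeriv i f) = spaceDeriv i (timeDeriv f) := by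
  funext t x
  rw [hf.smooth_spaceDeriv.timeDeriv_eq, hf.smooth_timeDeriv.spaceDeriv_eq,
    funext fun p : ℝ × Sp3 => hf.spaceDeriv_eq (i := i) p.1 p.2,
    funext fun p : ℝ × Sp3 => hf.timeDeriv_eq p.1 p.2]
  exact fderiv_fderiv_apply_comm hf _ _ _

theorem IsSmooth.spaceDeriv_comm (hf : IsSmooth f) :
    spaceDeriv i (spaceDeriv j f) = spaceDeriv j (spaceDeriv i f) := by
  funext t x
  exact fderiv_fderiv_apply_comm (hf.contDiff_space t) _ _ _

theorem IsSmooth.add (hf : IsSmooth f) (hg : IsSmooth g) : IsSmooth (f + g) :=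
  ContDiff.add hf hg

theorem IsSmooth.sub (hf : IsSmooth f) (hg : IsSmooth g) : IsSmooth (f - g) :=
  ContDiff.sub hf hg

theorem IsSmooth.sum {f : Fin 3 → ℝ → Sp3 → ℝ} (hf : ∀ k, IsSmooth (f k)) :
    IsSmooth (∑ k, f k) := by
  have := ContDiff.sum (s := Finset.univ) fun k _ => hf k
  simpa [IsSmooth] using this

theorem IsSmooth.timeDeriv_add (hf : IsSmooth f) (hg : IsSmooth g) :
    timeDeriv (f + g) = timeDeriv f + timeDeriv g := by
  funext t x
  exact deriv_fun_add (hf.differentiable_time x t) (hg.differentiable_time x t)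

theorem IsSmooth.timeDeriv_sub (hf : IsSmooth f) (hg : IsSmooth g) :
    timeDeriv (f - g) = timeDeriv f - timeDeriv g := by
  funext t x
  exact deriv_fun_sub (hf.differentiable_time x t) (hg.differentiable_time x t)

theorem IsSmooth.timeDeriv_sum {f : Fin 3 → ℝ → Sp3 → ℝ} (hf : ∀ k, IsSmooth (f k)) :
    timeDeriv (∑ k, f k) = ∑ k, timeDeriv (f k) := by
  funext t x
  have := deriv_fun_sum (u := Finset.univ) fun k _ => (hf k).differentiable_time x t
  simpa [timeDeriv] using this

theorem IsSmooth.spaceDeriv_add (hf : IsSmooth f) (hg : IsSmooth g) :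
    spaceDeriv i (f + g) = spaceDeriv i f + spaceDeriv i g := by
  funext t x
  simp [spaceDeriv, pd, fderiv_add (hf.differentiable_space t x)
    (hg.differentiable_space t x)]

theorem IsSmooth.spaceDeriv_sub (hf : IsSmooth f) (hg : IsSmooth g) :
    spaceDeriv i (f - g) = spaceDeriv i f - spaceDeriv i g := by
  funext t x
  simp [spaceDeriv, pd, fderiv_sub (hf.differentiable_space t x)
    (hg.differentiable_space t x)]

theorem IsSmooth.spaceDeriv_sum {f : Fin 3 → ℝ → Sp3 → ℝ} (hf : ∀ k, IsSmooth (f k)) :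
    spaceDeriv i (∑ k, f k) = ∑ k, spaceDeriv i (f k) := by
  funext t x
  simp [spaceDeriv, pd, fderiv_sum fun k _ => (hf k).differentiable_space t x]

end Calculus

section Support

/-- For functions on spacetime, space-compactness means vanishing outside a ball that is uniform
on every bounded time interval. -/
theorem spaceCompact_iff_s10 {f : ℝ → Sp3 → ℝ} :
    SpaceCompact f ↔ ∀ T : ℝ, ∃ R : ℝ, ∀ t x, |t| < T → R < ‖x‖ → f t x = 0 := by
  constructor
  · intro h T
    obtain ⟨R, hR⟩ := (h T).isBounded.exists_norm_le
    refine ⟨R, fun t x ht hx => ?_⟩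
    by_contra hne
    have := hR (t, x) ⟨subset_tsupport _ hne, abs_le.1 ht.le, mem_univ _⟩
    exact absurd ((norm_snd_le (t, x)).trans this) (not_le.2 hx)
  · intro h T
    obtain ⟨R, hR⟩ := h (T + 1)
    refine ((isCompact_Icc (a := -T) (b := T)).prod
      (isCompact_closedBall (0 : Sp3) R)).of_isClosed_subset
      ((isClosed_tsupport _).inter (isClosed_Icc.prod isClosed_univ)) ?_
    rintro ⟨t, x⟩ ⟨hs, ht, -⟩
    refine ⟨ht, ?_⟩
    by_contra hx
    rw [mem_closedBall_zero_iff, not_le] at hx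
    refine notMem_tsupport_iff_eventuallyEq.2 ?_ hs
    have ho : IsOpen {p : ℝ × Sp3 | |p.1| < T + 1 ∧ R < ‖p.2‖} :=
      (isOpen_lt (continuous_abs.comp continuous_fst) continuous_const).inter
        (isOpen_lt continuous_const (continuous_norm.comp continuous_snd))
    filter_upwards [ho.mem_nhds ⟨(abs_le.2 ht).trans_lt (lt_add_one T), hx⟩] with p hp
    exact hR _ _ hp.1 hp.2

theorem pd_eq_zero_of_forall_lt_norm {h : Sp3 → ℝ} {R : ℝ} (hh : ∀ y, R < ‖y‖ → h y = 0)
    {x : Sp3} (hx : R < ‖x‖) (i : Fin 3) : pd i h x = 0 := by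
  have : h =ᶠ[𝓝 x] fun _ => 0 := by
    filter_upwards [(isOpen_lt continuous_const continuous_norm).mem_nhds hx] with y hy
    exact hh y hy
  simp [pd, this.fderiv_eq]

theorem SpaceCompact.spaceDeriv {f : ℝ → Sp3 → ℝ} (hf : SpaceCompact f) (i : Fin 3) :
    SpaceCompact (spaceDeriv i f) := by
  refine spaceCompact_iff_s10.2 fun T => ?_
  obtain ⟨R, hR⟩ := spaceCompact_iff_s10.1 hf T
  exact ⟨R, fun t x ht hx => pd_eq_zero_of_forall_lt_norm (fun y hy => hR t y ht hy) hx i⟩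

theorem SpaceCompact.comp₂ {f g : ℝ → Sp3 → ℝ} (hf : SpaceCompact f) (hg : SpaceCompact g)
    {op : ℝ → ℝ → ℝ} (hop : op 0 0 = 0) : SpaceCompact fun t x => op (f t x) (g t x) := by
  refine spaceCompact_iff_s10.2 fun T => ?_
  obtain ⟨R, hR⟩ := spaceCompact_iff_s10.1 hf T
  obtain ⟨S, hS⟩ := spaceCompact_iff_s10.1 hg T
  refine ⟨max R S, fun t x ht hx => ?_⟩
  rw [hR t x ht ((le_max_left R S).trans_lt hx), hS t x ht ((le_max_right R S).trans_lt hx), hop]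

end Support

section TimePrimitive

/-- The primitive in time, vanishing at time zero, of a function on spacetime. -/
def timePrimitive (f : ℝ → Sp3 → ℝ) (t : ℝ) (x : Sp3) : ℝ := ∫ s in (0 : ℝ)..t, f s x

variable {f : ℝ → Sp3 → ℝ}

theorem IsSmooth.smooth_timePrimitive (hf : IsSmooth f) : IsSmooth (timePrimitive f) := by
  have hs : ContDiff ℝ ∞ fun q : (ℝ × Sp3) × ℝ => f (q.1.1 * q.2) q.1.2 :=
    ContDiff.comp (g := fun p : ℝ × Sp3 => f p.1 p.2)
      (f := fun q : (ℝ × Sp3) × ℝ => (q.1.1 * q.2, q.1.2)) hf (by fun_prop)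
  have hi := hs.integral_of_ae_mem_isCompact (μ := volume.restrict (Ioc (0 : ℝ) 1))
    (isCompact_Icc (a := (0 : ℝ)) (b := 1))
    ((ae_restrict_mem measurableSet_Ioc).mono fun _ hv => Ioc_subset_Icc_self hv)
  have : (fun p : ℝ × Sp3 => timePrimitive f p.1 p.2) =
      fun p => p.1 * ∫ v in Ioc (0 : ℝ) 1, f (p.1 * v) p.2 := by
    funext p
    have := intervalIntegral.smul_integral_comp_mul_left (a := 0) (b := 1)
      (fun s => f s p.2) p.1
    rw [mul_zero, mul_one, intervalIntegral.integral_of_le zero_le_one] at this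
    exact this.symm
  rw [IsSmooth, this]
  exact contDiff_fst.mul hi

theorem IsSmooth.timeDeriv_timePrimitive (hf : IsSmooth f) :
    timeDeriv (timePrimitive f) = f := by
  funext t x
  exact (hf.contDiff_time x).continuous.deriv_integral (fun r => f r x) 0 t

theorem SpaceCompact.timePrimitive (hf : SpaceCompact f) :
    SpaceCompact (timePrimitive f) := by
  refine spaceCompact_iff_s10.2 fun T => ?_
  obtain ⟨R, hR⟩ := spaceCompact_iff_s10.1 hf T
  refine ⟨R, fun t x ht hx => ?_⟩
  refine intervalIntegral.integral_zero_ae (Eventually.of_forall fun s hs => hR s x ?_ hx)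
  have := abs_sub_left_of_mem_uIcc (uIoc_subset_uIcc hs)
  simp only [sub_zero] at this
  exact this.trans_lt ht

end TimePrimitive

section SphericalMean

/-- The rotation by the angle `θ` in the plane spanned by the coordinate directions `i` and `j`. -/
def planeRotation (i j : Fin 3) (θ : ℝ) (v : Sp3) : Sp3 :=
  v + (Real.cos θ - 1) • (v i • sdir i + v j • sdir j)
    + Real.sin θ • (v i • sdir j - v j • sdir i)

theorem norm_planeRotation {i j : Fin 3} (hij : i ≠ j) (θ : ℝ) (v : Sp3) :
    ‖planeRotation i j θ v‖ = ‖v‖ := by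
  rw [EuclideanSpace.norm_eq, EuclideanSpace.norm_eq]
  congr 1
  have h := Real.sin_sq_add_cos_sq θ
  fin_cases i <;> fin_cases j <;> first | exact absurd rfl hij | skip
  all_goals
    simp [planeRotation, sdir, Fin.sum_univ_three]
    grind

/-- The rotation in a coordinate plane, as a linear isometry of space. -/
def planeRotationEquiv {i j : Fin 3} (hij : i ≠ j) (θ : ℝ) : Sp3 ≃ₗᵢ[ℝ] Sp3 :=
  LinearIsometry.toLinearIsometryEquiv
    { toFun := planeRotation i j θ
      map_add' := fun v w => by simp only [planeRotation, PiLp.add_apply]; module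
      map_smul' := fun c v => by
        simp only [planeRotation, PiLp.smul_apply, smul_eq_mul, RingHom.id_apply]; module
      norm_map' := norm_planeRotation hij θ } rfl

/-- The radial projection of Lebesgue measure on the unit ball: up to a constant factor, the
surface measure of the unit sphere. -/
def sphereMeasure : Measure Sp3 :=
  (volume.restrict (Metric.ball 0 1)).map fun y => ‖y‖⁻¹ • y

theorem measurable_normalize : Measurable fun y : Sp3 => ‖y‖⁻¹ • y :=
  measurable_norm.inv.smul measurable_id

instance : IsFiniteMeasure (volume.restrict (Metric.ball (0 : Sp3) 1)) :=
  ⟨by rw [Measure.restrict_apply_univ]; exact measure_ball_lt_top⟩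

instance : IsFiniteMeasure sphereMeasure := Measure.isFiniteMeasure_map _ _

theorem sphereMeasure_real_univ_pos : 0 < sphereMeasure.real univ := by
  rw [sphereMeasure, map_measureReal_apply measurable_normalize MeasurableSet.univ]
  simp only [preimage_univ, measureReal_restrict_apply_univ]
  exact ENNReal.toReal_pos (Metric.measure_ball_pos volume _ one_pos).ne' measure_ball_lt_top.ne

theorem ae_norm_eq_one : ∀ᵐ v ∂sphereMeasure, ‖v‖ = 1 := by
  rw [sphereMeasure, ae_map_iff measurable_normalize.aemeasurable
    (measurableSet_eq_fun measurable_norm measurable_const)]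
  have h : ∀ᵐ y : Sp3, y ≠ 0 := by simp [ae_iff]
  filter_upwards [ae_restrict_of_ae h] with y hy
  rw [norm_smul, norm_inv, norm_norm, inv_mul_cancel₀ (norm_ne_zero_iff.2 hy)]

theorem ae_mem_closedBall : ∀ᵐ v ∂sphereMeasure, v ∈ Metric.closedBall (0 : Sp3) 1 :=
  ae_norm_eq_one.mono fun v hv => by simp [hv]

theorem integrable_sphereMeasure {h : Sp3 → ℝ} (hh : Continuous h) :
    Integrable h sphereMeasure :=
  hh.integrable_of_ae_mem_isCompact (isCompact_closedBall 0 1) ae_mem_closedBall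

theorem integral_sum_sphereMeasure {f : Fin 3 → Sp3 → ℝ} (hf : ∀ k, Continuous (f k)) :
    ∫ v, ∑ k, f k v ∂sphereMeasure = ∑ k, ∫ v, f k v ∂sphereMeasure :=
  integral_finsetSum _ fun k _ => integrable_sphereMeasure (hf k)

theorem integral_comp_linearIsometryEquiv (R : Sp3 ≃ₗᵢ[ℝ] Sp3) {h : Sp3 → ℝ}
    (hh : Continuous h) : ∫ v, h (R v) ∂sphereMeasure = ∫ v, h v ∂sphereMeasure := by
  have hp : MeasurePreserving R (volume.restrict (Metric.ball 0 1))
      (volume.restrict (Metric.ball 0 1)) := by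
    have := R.measurePreserving.restrict_preimage_emb R.toHomeomorph.measurableEmbedding
      (Metric.ball 0 1)
    simpa using this
  rw [sphereMeasure,
    integral_map (f := fun v => h (R v)) measurable_normalize.aemeasurable
      (hh.comp R.continuous).aestronglyMeasurable,
    integral_map measurable_normalize.aemeasurable hh.aestronglyMeasurable,
    ← hp.integral_comp R.toHomeomorph.measurableEmbedding fun y => h (‖y‖⁻¹ • y)]
  simp

theorem fderiv_eq_sum_pd (h : Sp3 → ℝ) (x v : Sp3) :
    fderiv ℝ h x v = ∑ k, v k * pd k h x := by
  have : v = ∑ k, v k • sdir k := by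
    ext l
    simp [sdir, Pi.single_apply]
  conv_lhs => rw [this]
  simp [pd]

/-- The surface measure is annihilated by the generators of rotations. -/
theorem integral_rotationField {i j : Fin 3} (hij : i ≠ j) {h : Sp3 → ℝ} (hh : ContDiff ℝ ∞ h) :
    ∫ v, (v i * pd j h v - v j * pd i h v) ∂sphereMeasure = 0 := by
  have hf : ContDiff ℝ ∞ fun q : ℝ × Sp3 => h (planeRotation i j q.1 q.2) := by
    refine hh.comp ?_
    unfold planeRotation
    have (k : Fin 3) : ContDiff ℝ ∞ fun q : ℝ × Sp3 => q.2 k := by fun_prop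
    fun_prop
  have h1 := hf.fderiv_integral_apply_of_ae_mem_isCompact
    (isCompact_closedBall 0 1) ae_mem_closedBall 0 1
  have h2 : (fun θ => ∫ v, h (planeRotation i j θ v) ∂sphereMeasure) =
      fun _ => ∫ v, h v ∂sphereMeasure :=
    funext fun θ => integral_comp_linearIsometryEquiv (planeRotationEquiv hij θ) hh.continuous
  simp only [h2, fderiv_fun_const, Pi.zero_apply, zero_apply] at h1
  rw [h1]
  refine integral_congr_ae (Eventually.of_forall fun v => ?_)
  have hr : HasDerivAt (fun θ => planeRotation i j θ v) (v i • sdir j - v j • sdir i) 0 := by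
    have hc := (Real.hasDerivAt_cos 0).sub_const 1
    have hs := Real.hasDerivAt_sin 0
    have := ((hc.smul_const (v i • sdir i + v j • sdir j)).const_add v).fun_add
      (hs.smul_const (v i • sdir j - v j • sdir i))
    simpa [planeRotation] using this
  have h0 : planeRotation i j 0 v = v := by simp [planeRotation]
  have hd : HasFDerivAt h (fderiv ℝ h v) (planeRotation i j 0 v) := by
    rw [h0]; exact (hh.differentiable (by simp) v).hasFDerivAt
  have := (hd.comp_hasDerivAt 0 hr).deriv
  simp only [Function.comp_def] at this
  simp [this, pd]

variable {h : Sp3 → ℝ}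

theorem ContDiff.pd (hh : ContDiff ℝ ∞ h) (k : Fin 3) : ContDiff ℝ ∞ (pd k h) :=
  (hh.fderiv_right (by simp)).clm_apply contDiff_const

theorem pd_comp_add_smul (hh : ContDiff ℝ ∞ h) (k : Fin 3) (x v : Sp3) (t : ℝ) :
    pd k (fun w => h (x + t • w)) v = t * pd k h (x + t • v) := by
  have h1 : HasFDerivAt (fun w : Sp3 => x + t • w) (t • ContinuousLinearMap.id ℝ Sp3) v :=
    ((hasFDerivAt_id v).const_smul t).const_add x
  have := ((hh.differentiable (by simp) (x + t • v)).hasFDerivAt.comp v h1).fderiv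
  simp only [Function.comp_def] at this
  simp [_root_.pd, this]

theorem hasDerivAt_comp_add_smul (hh : ContDiff ℝ ∞ h) (x v : Sp3) (t : ℝ) :
    HasDerivAt (fun r => h (x + r • v)) (∑ k, v k * pd k h (x + t • v)) t := by
  rw [← fderiv_eq_sum_pd]
  have h1 : HasDerivAt (fun r : ℝ => x + r • v) v t := by
    simpa using ((hasDerivAt_id t).smul_const v).const_add x
  exact (hh.differentiable (by simp) _).hasFDerivAt.comp_hasDerivAt t h1

/-- The Euler–Poisson–Darboux equation, integrated over the unit sphere. -/
theorem integral_darboux (hh : ContDiff ℝ ∞ h) (x : Sp3) (t : ℝ) :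
    ∫ v, (2 * ∑ k, v k * pd k h (x + t • v)
      + t * ∑ k, v k * ∑ l, v l * pd l (pd k h) (x + t • v)) ∂sphereMeasure
      = ∫ v, t * ∑ k, pd k (pd k h) (x + t • v) ∂sphereMeasure := by
  let κ (i j : Fin 3) (v : Sp3) : ℝ := v i * pd j h (x + t • v) - v j * pd i h (x + t • v)
  let L (i j : Fin 3) (v : Sp3) : ℝ := v i * pd j (κ i j) v - v j * pd i (κ i j) v
  have hP (k : Fin 3) : ContDiff ℝ ∞ fun v => pd k h (x + t • v) := (hh.pd k).comp (by fun_prop)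
  have hX (k : Fin 3) : ContDiff ℝ ∞ fun v : Sp3 => v k := by fun_prop
  have hκ (i j : Fin 3) : ContDiff ℝ ∞ (κ i j) := ((hX i).mul (hP j)).sub ((hX j).mul (hP i))
  have hL (i j : Fin 3) : Integrable (L i j) sphereMeasure :=
    integrable_sphereMeasure
      (((hX i).mul ((hκ i j).pd j)).sub ((hX j).mul ((hκ i j).pd i))).continuous
  have h0 (i j : Fin 3) (hij : i ≠ j) : ∫ v, L i j v ∂sphereMeasure = 0 :=
    integral_rotationField hij (hκ i j)
  have hpd (k i j : Fin 3) (v : Sp3) : pd k (κ i j) v =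
      (sdir k i * pd j h (x + t • v) + v i * (t * pd k (pd j h) (x + t • v)))
      - (sdir k j * pd i h (x + t • v) + v j * (t * pd k (pd i h) (x + t • v))) := by
    have hx (i : Fin 3) : HasFDerivAt (fun v : Sp3 => v i)
        (EuclideanSpace.proj i : Sp3 →L[ℝ] ℝ) v :=
      (EuclideanSpace.proj i : Sp3 →L[ℝ] ℝ).hasFDerivAt
    have hp (i : Fin 3) := ((hP i).differentiable (by simp) v).hasFDerivAt
    have := (((hx i).mul (hp j)).sub ((hx j).mul (hp i))).fderiv
    have h2 (i : Fin 3) := pd_comp_add_smul (hh.pd i) k x v t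
    rw [← h2, ← h2]
    change fderiv ℝ (κ i j) v (sdir k) = _
    rw [show fderiv ℝ (κ i j) v = _ from this]
    simp [_root_.pd]
    ring
  have hsym (k l : Fin 3) (y : Sp3) : pd k (pd l h) y = pd l (pd k h) y :=
    fderiv_fderiv_apply_comm hh y _ _
  have key : ∀ᵐ v ∂sphereMeasure,
      (2 * ∑ k, v k * pd k h (x + t • v)
      + t * ∑ k, v k * ∑ l, v l * pd l (pd k h) (x + t • v))
      = t * ∑ k, pd k (pd k h) (x + t • v) - (L 0 1 v + L 0 2 v + L 1 2 v) := by
    filter_upwards [ae_norm_eq_one] with v hv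
    have hn : v 0 ^ 2 + v 1 ^ 2 + v 2 ^ 2 = 1 := by
      have := EuclideanSpace.norm_sq_eq v
      simpa [hv, Fin.sum_univ_three] using this.symm
    simp only [L, hpd, Fin.sum_univ_three, hsym 1 0, hsym 2 0, hsym 2 1]
    simp [sdir]
    linear_combination (t * (pd 0 (pd 0 h) (x + t • v) + pd 1 (pd 1 h) (x + t • v)
      + pd 2 (pd 2 h) (x + t • v))) * hn
  have hΔ : Integrable (fun v => t * ∑ k, pd k (pd k h) (x + t • v)) sphereMeasure :=
    integrable_sphereMeasure (continuous_const.mul (continuous_finsetSum _ fun k _ =>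
      ((hh.pd k).pd k).continuous.comp (by fun_prop)))
  have hL₂ : Integrable (fun v => L 0 1 v + L 0 2 v) sphereMeasure := (hL 0 1).add (hL 0 2)
  have hL₃ : Integrable (fun v => L 0 1 v + L 0 2 v + L 1 2 v) sphereMeasure := hL₂.add (hL 1 2)
  rw [integral_congr_ae key, integral_sub hΔ hL₃, integral_add hL₂ (hL 1 2),
    integral_add (hL 0 1) (hL 0 2),
    h0 0 1 (by decide), h0 0 2 (by decide), h0 1 2 (by decide)]
  simp

end SphericalMean

section Kirchhoff

/-- The average of `h` over the sphere of radius `|t|` centred at `x`. -/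
def sphericalMean (h : Sp3 → ℝ) (t : ℝ) (x : Sp3) : ℝ :=
  (sphereMeasure.real univ)⁻¹ * ∫ v, h (x + t • v) ∂sphereMeasure

/-- Kirchhoff's solution of the wave equation with initial value `0` and initial velocity `h`. -/
def kirchhoff (h : Sp3 → ℝ) (t : ℝ) (x : Sp3) : ℝ := t * sphericalMean h t x

variable {h : Sp3 → ℝ}

theorem isSmooth_sphericalMean (hh : ContDiff ℝ ∞ h) : IsSmooth (sphericalMean h) := by
  have : ContDiff ℝ ∞ fun q : (ℝ × Sp3) × Sp3 => h (q.1.2 + q.1.1 • q.2) := hh.comp (by fun_prop)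
  exact contDiff_const.mul
    (this.integral_of_ae_mem_isCompact (isCompact_closedBall 0 1) ae_mem_closedBall)

theorem isSmooth_kirchhoff (hh : ContDiff ℝ ∞ h) : IsSmooth (kirchhoff h) :=
  contDiff_fst.mul (isSmooth_sphericalMean hh)

theorem pd_const_mul {f : Sp3 → ℝ} (hf : Differentiable ℝ f) (c : ℝ) (i : Fin 3) (x : Sp3) :
    pd i (fun y => c * f y) x = c * pd i f x := by
  simp [pd, fderiv_const_mul (hf x)]

theorem spaceDeriv_sphericalMean (hh : ContDiff ℝ ∞ h) (i : Fin 3) :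
    spaceDeriv i (sphericalMean h) = sphericalMean (pd i h) := by
  funext t x
  have hs : ContDiff ℝ ∞ fun q : Sp3 × Sp3 => h (q.1 + t • q.2) := hh.comp (by fun_prop)
  have hi := hs.integral_of_ae_mem_isCompact (isCompact_closedBall 0 1) ae_mem_closedBall
  have := hs.fderiv_integral_apply_of_ae_mem_isCompact
    (isCompact_closedBall 0 1) ae_mem_closedBall x (sdir i)
  simp only [fderiv_comp_add_right] at this
  exact (pd_const_mul (hi.differentiable (by simp)) _ i x).trans (congrArg _ this)

theorem spaceDeriv_kirchhoff (hh : ContDiff ℝ ∞ h) (i : Fin 3) :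
    spaceDeriv i (kirchhoff h) = kirchhoff (pd i h) := by
  funext t x
  exact (pd_const_mul ((isSmooth_sphericalMean hh).differentiable_space t) t i x).trans
    (congrArg _ (congrFun₂ (spaceDeriv_sphericalMean hh i) t x))

theorem hasDerivAt_integral_weighted {g : Sp3 → ℝ} (hg : ContDiff ℝ ∞ g)
    (hh : ContDiff ℝ ∞ h) (t : ℝ) (x : Sp3) :
    HasDerivAt (fun r => ∫ v, g v * h (x + r • v) ∂sphereMeasure)
      (∫ v, g v * ∑ k, v k * pd k h (x + t • v) ∂sphereMeasure) t := by
  have hs : ContDiff ℝ ∞ fun q : ℝ × Sp3 => g q.2 * h (x + q.1 • q.2) :=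
    (hg.comp contDiff_snd).mul (hh.comp (by fun_prop))
  have hi := hs.integral_of_ae_mem_isCompact (isCompact_closedBall 0 1) ae_mem_closedBall
  have := hs.fderiv_integral_apply_of_ae_mem_isCompact
    (isCompact_closedBall 0 1) ae_mem_closedBall t 1
  simp only [fderiv_apply_one_eq_deriv,
    fun v => ((hasDerivAt_comp_add_smul hh x v t).const_mul (g v)).deriv] at this
  rw [← this]
  exact (hi.differentiable (by simp) t).hasDerivAt

theorem hasDerivAt_sphericalMean (hh : ContDiff ℝ ∞ h) (t : ℝ) (x : Sp3) :
    HasDerivAt (fun r => sphericalMean h r x) ((sphereMeasure.real univ)⁻¹ *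
      ∫ v, ∑ k, v k * pd k h (x + t • v) ∂sphereMeasure) t := by
  have := (hasDerivAt_integral_weighted (g := fun _ => 1) contDiff_const hh t x).const_mul
    (sphereMeasure.real univ)⁻¹
  simp only [one_mul] at this
  exact this

theorem hasDerivAt_hasDerivAt_sphericalMean (hh : ContDiff ℝ ∞ h) (t : ℝ) (x : Sp3) :
    HasDerivAt (fun r => (sphereMeasure.real univ)⁻¹ *
        ∫ v, ∑ k, v k * pd k h (x + r • v) ∂sphereMeasure)
      ((sphereMeasure.real univ)⁻¹ *
        ∫ v, ∑ k, v k * ∑ l, v l * pd l (pd k h) (x + t • v) ∂sphereMeasure) t := by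
  have hc (k : Fin 3) (r : ℝ) : Continuous fun v => pd k h (x + r • v) :=
    (hh.pd k).continuous.comp (by fun_prop)
  have hc' (k l : Fin 3) : Continuous fun v => pd l (pd k h) (x + t • v) :=
    ((hh.pd k).pd l).continuous.comp (by fun_prop)
  have := HasDerivAt.fun_sum (u := Finset.univ) fun k _ =>
    hasDerivAt_integral_weighted (g := fun v => v k) (by fun_prop) (hh.pd k) t x
  have hr (r : ℝ) := integral_sum_sphereMeasure (f := fun k v => v k * pd k h (x + r • v))
    fun k => by fun_prop
  have ht := integral_sum_sphereMeasure
    (f := fun k v => v k * ∑ l, v l * pd l (pd k h) (x + t • v)) fun k => by fun_prop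
  simp only [hr, ht]
  exact this.const_mul _

theorem timeDeriv_kirchhoff (hh : ContDiff ℝ ∞ h) (t : ℝ) (x : Sp3) :
    timeDeriv (kirchhoff h) t x = sphericalMean h t x + t * ((sphereMeasure.real univ)⁻¹ *
      ∫ v, ∑ k, v k * pd k h (x + t • v) ∂sphereMeasure) := by
  have := ((hasDerivAt_id t).fun_mul (hasDerivAt_sphericalMean hh t x)).deriv
  rwa [one_mul] at this

theorem timeDeriv_kirchhoff_zero (hh : ContDiff ℝ ∞ h) (x : Sp3) :
    timeDeriv (kirchhoff h) 0 x = h x := by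
  rw [timeDeriv_kirchhoff hh]
  simp [sphericalMean, sphereMeasure_real_univ_pos.ne']

theorem kirchhoff_wave (hh : ContDiff ℝ ∞ h) :
    timeDeriv (timeDeriv (kirchhoff h)) = ∑ i, spaceDeriv i (spaceDeriv i (kirchhoff h)) := by
  funext t x
  have h1 := (hasDerivAt_sphericalMean hh t x).add
    ((hasDerivAt_id t).mul (hasDerivAt_hasDerivAt_sphericalMean hh t x))
  have h2 : timeDeriv (timeDeriv (kirchhoff h)) t x = _ :=
    (congrArg (fun f => deriv f t) (funext fun r => timeDeriv_kirchhoff hh r x)).trans h1.deriv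
  have hc (k : Fin 3) : Continuous fun v => pd k h (x + t • v) :=
    (hh.pd k).continuous.comp (by fun_prop)
  have hc' (k l : Fin 3) : Continuous fun v => pd l (pd k h) (x + t • v) :=
    ((hh.pd k).pd l).continuous.comp (by fun_prop)
  have h3 := integral_darboux hh x t
  rw [integral_add (integrable_sphereMeasure (by fun_prop))
    (integrable_sphereMeasure (by fun_prop)), integral_const_mul, integral_const_mul,
    integral_const_mul, integral_sum_sphereMeasure fun k => hc' k k] at h3
  rw [h2]
  simp only [spaceDeriv_kirchhoff hh, spaceDeriv_kirchhoff (hh.pd _), Finset.sum_apply,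
    kirchhoff, sphericalMean, ← Finset.mul_sum, id]
  linear_combination (sphereMeasure.real univ)⁻¹ * h3

theorem spaceCompact_kirchhoff {R : ℝ} (hR : ∀ x, R < ‖x‖ → h x = 0) :
    SpaceCompact (kirchhoff h) := by
  refine spaceCompact_iff_s10.2 fun T => ⟨R + T, fun t x ht hx => ?_⟩
  have : (fun v => h (x + t • v)) =ᵐ[sphereMeasure] 0 := by
    filter_upwards [ae_norm_eq_one] with v hv
    refine hR _ ?_
    have h1 := norm_sub_le (x + t • v) (t • v)
    rw [add_sub_cancel_right, norm_smul, hv, mul_one, Real.norm_eq_abs] at h1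
    linarith
  simp [kirchhoff, sphericalMean, integral_congr_ae this]

end Kirchhoff

/-- Every smooth space-compact solution of the free Maxwell equations is
gauge-equivalent to a space-compact solution in the Lorentz gauge, each component of
which satisfies the wave equation. -/
theorem stmt_10 (A₀ : ℝ → Sp3 → ℝ) (A : Fin 3 → ℝ → Sp3 → ℝ) (hA : IsMaxwell A₀ A) :
    ∃ χ : ℝ → Sp3 → ℝ, ContDiff ℝ (⊤ : ℕ∞) (fun p : ℝ × Sp3 => χ p.1 p.2) ∧
      SpaceCompact (fun t x => A₀ t x + deriv (fun r => χ r x) t) ∧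
      (∀ i, SpaceCompact (fun t x => A i t x + pd i (χ t) x)) ∧
      (∀ (t : ℝ) (x : Sp3),
        -(deriv (fun r => A₀ r x + deriv (fun q => χ q x) r) t)
          + ∑ i, pd i (fun y => A i t y + pd i (χ t) y) x = 0) ∧
      (∀ (t : ℝ) (x : Sp3),
        deriv (deriv (fun r => A₀ r x + deriv (fun q => χ q x) r)) t
          = lap (fun y => A₀ t y + deriv (fun q => χ q y) t) x) ∧
      (∀ (i : Fin 3) (t : ℝ) (x : Sp3),
        deriv (deriv (fun r => A i r x + pd i (χ r) x)) t
          = lap (fun y => A i t y + pd i (χ t) y) x) := by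
  obtain ⟨hA₀, hAi, cA₀, cA, gauss, ampere⟩ := hA
  have sA₀ : IsSmooth A₀ := hA₀
  have sA (i : Fin 3) : IsSmooth (A i) := hAi i
  set D : ℝ → Sp3 → ℝ := ∑ j, spaceDeriv j (A j) with hD
  have hdivg : divg A = D := by
    funext t x
    simp [hD, divg, spaceDeriv]
  have sD : IsSmooth D := IsSmooth.sum fun j => (sA j).smooth_spaceDeriv
  have cD : SpaceCompact D := by
    simp only [hD, Fin.sum_univ_three]
    exact (((cA 0).spaceDeriv 0).comp₂ ((cA 1).spaceDeriv 1) (op := (· + ·)) (add_zero 0)).comp₂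
      ((cA 2).spaceDeriv 2) (op := (· + ·)) (add_zero 0)
  obtain ⟨R, hR⟩ := spaceCompact_iff_s10.1 cD 1
  set w := kirchhoff (D 0) with hw
  have sw : IsSmooth w := isSmooth_kirchhoff (sD.contDiff_space 0)
  have cw : SpaceCompact w := spaceCompact_kirchhoff fun x hx => hR 0 x (by simp) hx
  set χ := timePrimitive (w - A₀)
  have sχ : IsSmooth χ := (sw.sub sA₀).smooth_timePrimitive
  have cχ : SpaceCompact χ := (cw.comp₂ cA₀ (op := (· - ·)) (sub_zero 0)).timePrimitive
  have tχ : timeDeriv χ = w - A₀ := (sw.sub sA₀).timeDeriv_timePrimitive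
  set Δχ : ℝ → Sp3 → ℝ := ∑ i, spaceDeriv i (spaceDeriv i χ) with hΔχ
  have sΔχ : IsSmooth Δχ := IsSmooth.sum fun i => sχ.smooth_spaceDeriv.smooth_spaceDeriv
  have wave : timeDeriv (timeDeriv w) = ∑ i, spaceDeriv i (spaceDeriv i w) :=
    kirchhoff_wave (sD.contDiff_space 0)
  have gauss' : timeDeriv D = ∑ i, spaceDeriv i (spaceDeriv i A₀) := by
    funext t x
    rw [← hdivg, Finset.sum_apply, Finset.sum_apply]
    exact (gauss t x).symm
  have lorenz : Δχ = timeDeriv w - D := by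
    have h0 : timeDeriv (Δχ + D - timeDeriv w) = 0 := by
      rw [(sΔχ.add sD).timeDeriv_sub sw.smooth_timeDeriv, sΔχ.timeDeriv_add sD, wave, gauss', hΔχ,
        IsSmooth.timeDeriv_sum fun i => sχ.smooth_spaceDeriv.smooth_spaceDeriv]
      simp only [sχ.smooth_spaceDeriv.timeDeriv_spaceDeriv, sχ.timeDeriv_spaceDeriv, tχ,
        sw.spaceDeriv_sub sA₀, sw.smooth_spaceDeriv.spaceDeriv_sub sA₀.smooth_spaceDeriv,
        Finset.sum_sub_distrib]
      abel
    have h1 (x : Sp3) : (Δχ + D - timeDeriv w) 0 x = 0 := by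
      have h2 : χ 0 = fun _ => 0 := funext fun x => intervalIntegral.integral_same
      have h3 (i : Fin 3) : spaceDeriv i χ 0 = fun _ => 0 := by
        funext y
        simp [spaceDeriv, pd, h2]
      have h4 : Δχ 0 x = 0 := by
        simp only [hΔχ, Finset.sum_apply]
        refine Finset.sum_eq_zero fun i _ => ?_
        rw [spaceDeriv, h3 i]
        simp [pd]
      simp [h4, hw, timeDeriv_kirchhoff_zero (sD.contDiff_space 0)]
    have h2 : Δχ + D - timeDeriv w = 0 := by
      funext t x
      refine Eq.trans ?_ (h1 x)
      exact is_const_of_deriv_eq_zero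
        (((sΔχ.add sD).sub sw.smooth_timeDeriv).differentiable_time x)
        (fun r => congrFun₂ h0 r x) t 0
    exact eq_sub_of_add_eq (sub_eq_zero.1 h2)
  have hB₀ : (fun t x => A₀ t x + deriv (fun r => χ r x) t) = w := by
    change A₀ + timeDeriv χ = w
    rw [tχ, add_sub_cancel]
  have hB (i : Fin 3) : (fun t x => A i t x + pd i (χ t) x) = A i + spaceDeriv i χ := rfl
  refine ⟨χ, sχ, hB₀ ▸ cw, fun i => (cA i).comp₂ (cχ.spaceDeriv i) (add_zero 0),
    fun t x => ?_, fun t x => ?_, fun i t x => ?_⟩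
  · have h1 : ∑ i, spaceDeriv i (A i + spaceDeriv i χ) = timeDeriv w := by
      simp only [(sA _).spaceDeriv_add sχ.smooth_spaceDeriv, Finset.sum_add_distrib]
      rw [← hD, ← hΔχ, lorenz, add_sub_cancel]
    have h2 := congrFun₂ h1 t x
    rw [Finset.sum_apply, Finset.sum_apply] at h2
    have h3 : deriv (fun r => A₀ r x + deriv (fun q => χ q x) r) t = timeDeriv w t x := by
      rw [← hB₀]; rfl
    rw [h3, neg_add_eq_zero]
    exact h2.symm
  · have h1 : timeDeriv (timeDeriv w) t x = lap (w t) x := by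
      rw [wave, Finset.sum_apply, Finset.sum_apply]; rfl
    rw [← hB₀] at h1
    exact h1
  · have h1 : timeDeriv (timeDeriv (A i)) =
        ∑ j, spaceDeriv j (spaceDeriv j (A i)) + spaceDeriv i (timeDeriv A₀ - D) := by
      funext t x
      refine (ampere i t x).trans ?_
      rw [hdivg, Pi.add_apply, Pi.add_apply, Finset.sum_apply, Finset.sum_apply]
      rfl
    have h2 : timeDeriv (timeDeriv (A i + spaceDeriv i χ)) =
        ∑ j, spaceDeriv j (spaceDeriv j (A i + spaceDeriv i χ)) := by
      have h3 (j : Fin 3) : spaceDeriv j (spaceDeriv j (A i + spaceDeriv i χ)) =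
          spaceDeriv j (spaceDeriv j (A i)) + spaceDeriv i (spaceDeriv j (spaceDeriv j χ)) := by
        rw [(sA i).spaceDeriv_add sχ.smooth_spaceDeriv,
          (sA i).smooth_spaceDeriv.spaceDeriv_add sχ.smooth_spaceDeriv.smooth_spaceDeriv,
          sχ.spaceDeriv_comm (i := j) (j := i), sχ.smooth_spaceDeriv.spaceDeriv_comm (i := j)]
      simp only [h3, Finset.sum_add_distrib]
      rw [← IsSmooth.spaceDeriv_sum fun j => sχ.smooth_spaceDeriv.smooth_spaceDeriv, ← hΔχ, lorenz,
        (sA i).timeDeriv_add sχ.smooth_spaceDeriv, sχ.timeDeriv_spaceDeriv, tχ,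
        (sA i).smooth_timeDeriv.timeDeriv_add (sw.sub sA₀).smooth_spaceDeriv, h1,
        (sw.sub sA₀).timeDeriv_spaceDeriv, sw.timeDeriv_sub sA₀,
        sw.smooth_timeDeriv.spaceDeriv_sub sA₀.smooth_timeDeriv,
        sA₀.smooth_timeDeriv.spaceDeriv_sub sD, sw.smooth_timeDeriv.spaceDeriv_sub sD]
      abel
    have h3 := congrFun₂ h2 t x
    rw [Finset.sum_apply, Finset.sum_apply] at h3
    exact h3

end
end
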